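/- There exists a constant c > 0 such that for every prime p > 2 and every finite set A ⊆ F_p with |A| ≤ p^(7/12), the set {(a-b)^3 + (c-d)^3 : a,b,c,d ∈ A} has cardinality at least c·|A|^(8/7). -/

import Mathlib

open Finset

namespace CubeExp

open Polynomial in
/-- total degree at most `k`, for bivariate polynomials. -/
def TotLe {F : Type*} [Field F] (k : ℕ) (q : Polynomial (Polynomial F)) : Prop :=
  ∀ i, q.coeff i ≠ 0 → (q.coeff i).natDegree + i ≤ k

section
open Polynomial
variable {F : Type*} [Field F]

lemma totLe_sub {k : ℕ} {q r : F[X][X]} (hq : TotLe k q) (hr : TotLe k r) :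
    TotLe k (q - r) := by
  intro i hi
  rw [coeff_sub] at hi ⊢
  have h := natDegree_sub_le (q.coeff i) (r.coeff i)
  by_cases h1 : q.coeff i = 0
  · by_cases h2 : r.coeff i = 0
    · simp [h1, h2] at hi
    · have := hr i h2
      simp only [h1, zero_sub, natDegree_neg]
      exact this
  · have h1' := hq i h1
    by_cases h2 : r.coeff i = 0
    · simpa [h2] using h1'
    · have := hr i h2
      omega

lemma totLe_mul {k l : ℕ} {q r : F[X][X]} (hq : TotLe k q) (hr : TotLe l r) :
    TotLe (k + l) (q * r) := by
  intro i hi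
  rw [coeff_mul] at hi ⊢
  have hik : i ≤ k + l := by
    by_contra hcon
    apply hi
    apply Finset.sum_eq_zero
    intro x hx
    rw [HasAntidiagonal.mem_antidiagonal] at hx
    by_contra hne
    have h1 := hq x.1 (left_ne_zero_of_mul hne)
    have h2 := hr x.2 (right_ne_zero_of_mul hne)
    omega
  have : (∑ x ∈ HasAntidiagonal.antidiagonal i, q.coeff x.1 * r.coeff x.2).natDegree ≤ k + l - i := by
    apply natDegree_sum_le_of_forall_le
    intro x hx
    rw [HasAntidiagonal.mem_antidiagonal] at hx
    by_cases hne : q.coeff x.1 * r.coeff x.2 = 0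
    · simp [hne]
    have h1 := hq x.1 (left_ne_zero_of_mul hne)
    have h2 := hr x.2 (right_ne_zero_of_mul hne)
    have := natDegree_mul_le (p := q.coeff x.1) (q := r.coeff x.2)
    omega
  omega

lemma totLe_X : TotLe 1 (X : F[X][X]) := by
  intro i hi
  rw [coeff_X] at hi ⊢
  split_ifs at hi ⊢ with h
  · subst h; simp
  · simp at hi

lemma totLe_one : TotLe 0 (1 : F[X][X]) := by
  intro i hi
  rw [coeff_one] at hi ⊢
  split_ifs at hi ⊢ with h
  · subst h; simp
  · simp at hi

lemma totLe_C {k : ℕ} {c : F[X]} (hc : c.natDegree ≤ k) : TotLe k (C c) := by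
  intro i hi
  rw [coeff_C] at hi ⊢
  split_ifs at hi ⊢ with h
  · subst h; simpa
  · simp at hi

lemma totLe_mono {k l : ℕ} (hkl : k ≤ l) {q : F[X][X]} (hq : TotLe k q) : TotLe l q :=
  fun i hi => (hq i hi).trans hkl

lemma totLe_prod {ι : Type*} (s : Finset ι) (f : ι → F[X][X]) (h : ∀ i ∈ s, TotLe 1 (f i)) :
    TotLe s.card (∏ i ∈ s, f i) := by
  classical
  induction s using Finset.induction_on with
  | empty => simpa using totLe_one
  | insert a s ha ih =>
    rw [Finset.prod_insert ha, Finset.card_insert_of_notMem ha, add_comm]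
    exact totLe_mul (h a (by simp)) (ih fun i hi => h i (by simp [hi]))

lemma totLe_X_pow_mod {P : F[X][X]} (hP : P.Monic) {N : ℕ} (hN : P.natDegree = N) (hN1 : 1 ≤ N)
    (hT : TotLe N P) (k : ℕ) : TotLe k ((X ^ k : F[X][X]) %ₘ P) := by
  induction k with
  | zero =>
    have : (X ^ 0 : F[X][X]) %ₘ P = 1 := by
      rw [pow_zero, modByMonic_eq_self_iff hP]
      rw [degree_eq_natDegree hP.ne_zero, hN, degree_one]
      exact_mod_cast hN1
    rw [this]; exact totLe_one
  | succ k ih =>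
    set r := (X ^ k : F[X][X]) %ₘ P with hr
    have hrdeg : r.degree < N := by
      have := degree_modByMonic_lt (X ^ k) hP
      rwa [degree_eq_natDegree hP.ne_zero, hN] at this
    set c := r.coeff (N - 1) with hc
    have hcdeg : c ≠ 0 → c.natDegree + (N - 1) ≤ k := fun h => ih _ h
    have key : (X ^ (k + 1) : F[X][X]) %ₘ P = X * r - C c * P := by
      have hdiv := modByMonic_add_div (X ^ k : F[X][X]) P
      have hdeg : (X * r - C c * P).degree < P.degree := by
        rw [degree_eq_natDegree hP.ne_zero, hN, degree_lt_iff_coeff_zero]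
        intro m hm
        rw [coeff_sub, coeff_C_mul]
        obtain ⟨m', rfl⟩ : ∃ m', m = m' + 1 := ⟨m - 1, by omega⟩
        rw [mul_comm X r, coeff_mul_X]
        rcases Nat.lt_or_ge N (m' + 1) with h | h
        · have h1 : r.coeff m' = 0 := (degree_lt_iff_coeff_zero _ _).1 hrdeg m' (by omega)
          have h2 : P.coeff (m' + 1) = 0 := coeff_eq_zero_of_natDegree_lt (by omega)
          simp [h1, h2]
        · have h3 : m' + 1 = N := by omega
          have h4 : P.coeff (m' + 1) = 1 := by
            rw [h3, ← hN]; exact hP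
          have h5 : m' = N - 1 := by omega
          rw [h4, mul_one, hc, h5, sub_self]
      refine (div_modByMonic_unique (X * ((X ^ k : F[X][X]) /ₘ P) + C c) _ hP ⟨?_, hdeg⟩).2
      rw [pow_succ]
      conv_rhs => rw [← hdiv]
      rw [← hr]; ring
    rw [key]
    apply totLe_sub
    · exact totLe_mono (by omega) (totLe_mul totLe_X ih)
    · by_cases h : c = 0
      · intro i hi; simp [h] at hi
      · exact totLe_mono (by have := hcdeg h; omega) (totLe_mul (totLe_C (k := k - (N - 1)) (by have := hcdeg h; omega)) hT)
end

/-- finite directions determined by `A × A`. -/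
def dirs {p : ℕ} [Fact p.Prime] (A : Finset (ZMod p)) : Finset (ZMod p) :=
  by classical exact univ.filter (fun y => ∃ q ∈ A ×ˢ A, ∃ q' ∈ A ×ˢ A, q ≠ q' ∧ q.2 - y * q.1 = q'.2 - y * q'.1)

open Polynomial in
lemma szonyi {p : ℕ} [Fact p.Prime] (A : Finset (ZMod p)) (h2 : 2 ≤ A.card) (hp : A.card ^ 2 ≤ p) :
    A.card ^ 2 ≤ 2 * (dirs A).card := by
  classical
  set n := A.card with hn
  set P : (ZMod p)[X][X] := ∏ q ∈ A ×ˢ A, (X - C (C q.2 - C q.1 * X)) with hPdef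
  have hPm : P.Monic := monic_prod_of_monic _ _ fun q _ => monic_X_sub_C _
  have hcard : (A ×ˢ A).card = n ^ 2 := by rw [card_product, sq]
  have hPd : P.natDegree = n ^ 2 := by
    rw [hPdef, natDegree_prod_of_monic _ _ (fun q _ => monic_X_sub_C _)]
    simp only [natDegree_X_sub_C, sum_const, hcard, smul_eq_mul, mul_one]
  have hPT : TotLe (n ^ 2) P := by
    rw [← hcard]
    apply totLe_prod
    intro q _
    refine totLe_sub totLe_X (totLe_C ?_)
    refine (natDegree_sub_le _ _).trans ?_
    simp only [natDegree_C, zero_le, sup_of_le_right]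
    exact (natDegree_mul_le).trans (by simp)
  have hn4 : 4 ≤ n ^ 2 := by nlinarith
  have hT := totLe_X_pow_mod hPm hPd (by omega) hPT p
  set Rm := (X ^ p : (ZMod p)[X][X]) %ₘ P with hRm
  -- specialisation
  have hspec : ∀ y : ZMod p, Rm.map (evalRingHom y) =
      (X ^ p : (ZMod p)[X]) %ₘ (∏ q ∈ A ×ˢ A, (X - C (q.2 - y * q.1))) := by
    intro y
    rw [hRm, map_modByMonic _ hPm, hPdef, Polynomial.map_prod]
    rw [Polynomial.map_pow, map_X]
    congr 1
    apply Finset.prod_congr rfl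
    intro q _
    rw [Polynomial.map_sub, map_X, map_C]
    congr 2
    simp only [coe_evalRingHom, eval_sub, eval_C, eval_mul, eval_X]
    ring
  have hzero_mem : (0 : ZMod p) ∈ dirs A := by
    obtain ⟨a, ha, b, hb, hab⟩ := Finset.one_lt_card.1 (show 1 < A.card by omega)
    simp only [dirs, mem_filter, mem_univ, true_and]
    exact ⟨(a, a), by simp [ha], (b, a), by simp [ha, hb], by simp [hab], by simp⟩
  -- non-directions
  have hnon : ∀ y : ZMod p, y ∉ dirs A → Rm.map (evalRingHom y) = X := by
    intro y hy
    rw [hspec]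
    have hmon : (∏ q ∈ A ×ˢ A, (X - C (q.2 - y * q.1)) : (ZMod p)[X]).Monic :=
      monic_prod_of_monic _ _ fun q _ => monic_X_sub_C _
    have hdeg : (∏ q ∈ A ×ˢ A, (X - C (q.2 - y * q.1)) : (ZMod p)[X]).natDegree = n ^ 2 := by
      rw [natDegree_prod_of_monic _ _ (fun q _ => monic_X_sub_C _)]
      simp only [natDegree_X_sub_C, sum_const, hcard, smul_eq_mul, mul_one]
    have hdvd : (∏ q ∈ A ×ˢ A, (X - C (q.2 - y * q.1)) : (ZMod p)[X]) ∣ X ^ p - X := by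
      apply Finset.prod_dvd_of_coprime
      · intro q hq q' hq' hne
        apply isCoprime_X_sub_C_of_isUnit_sub
        rw [isUnit_iff_ne_zero, sub_ne_zero]
        intro heq
        apply hy
        simp only [dirs, mem_filter, mem_univ, true_and]
        exact ⟨q, hq, q', hq', hne, heq⟩
      · intro q _
        rw [dvd_iff_isRoot]
        simp [ZMod.pow_card]
    obtain ⟨Q, hQ⟩ := hdvd
    refine (div_modByMonic_unique Q _ hmon ⟨?_, ?_⟩).2
    · rw [← hQ]; ring
    · rw [degree_eq_natDegree hmon.ne_zero, hdeg, degree_X]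
      exact_mod_cast (by omega : 1 < n ^ 2)
  -- vanishing of high coefficients
  have hvan : ∀ i, (dirs A).card < i → i ≠ 1 → Rm.coeff i = 0 := by
    intro i hi hi1
    by_contra hne
    have hd := hT i hne
    have : (dirs A)ᶜ.card ≤ (Rm.coeff i).natDegree := by
      apply Polynomial.card_le_degree_of_subset_roots
      intro y hy
      have hy' : y ∉ dirs A := by simpa using hy
      rw [mem_roots hne, IsRoot.def]
      have h1 := congrArg (fun f => coeff f i) (hnon y hy')
      simp only [coeff_map, coe_evalRingHom, coeff_X] at h1
      rw [h1, if_neg (Ne.symm hi1)]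
    rw [card_compl, ZMod.card] at this
    omega
  have hd1 : 1 ≤ (dirs A).card := Finset.card_pos.2 ⟨0, hzero_mem⟩
  set rem := Rm.map (evalRingHom 0) with hrem
  have hremdeg : rem.natDegree ≤ (dirs A).card := by
    rw [natDegree_le_iff_coeff_eq_zero]
    intro i hi
    rw [hrem, coeff_map, hvan i hi (by omega), map_zero]
  set F0 : (ZMod p)[X] := ∏ q ∈ A ×ˢ A, (X - C (q.2 - 0 * q.1)) with hF0
  have hF0m : F0.Monic := monic_prod_of_monic _ _ fun q _ => monic_X_sub_C _
  have hF0d : F0.natDegree = n ^ 2 := by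
    rw [hF0, natDegree_prod_of_monic _ _ (fun q _ => monic_X_sub_C _)]
    simp only [natDegree_X_sub_C, sum_const, hcard, smul_eq_mul, mul_one]
  have hF0eq : F0 = ∏ b ∈ A, (X - C b) ^ n := by
    rw [hF0, Finset.prod_product_right]
    simp [hn]
  have hF0dvd : F0 ∣ X ^ p - rem := by
    rw [hrem, hspec 0, ← hF0]
    exact ⟨X ^ p /ₘ F0, by
      have := modByMonic_add_div (X ^ p) F0
      linear_combination -this⟩
  have hpow : ∀ b ∈ A, (X - C b) ^ n ∣ X ^ p - rem := fun b hb =>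
    (hF0eq ▸ Finset.dvd_prod_of_mem _ hb : (X - C b) ^ n ∣ F0).trans hF0dvd
  have hev : ∀ b ∈ A, rem.eval b = b := by
    intro b hb
    have h1 : (X - C b) ∣ X ^ p - rem := (dvd_pow_self _ (by omega)).trans (hpow b hb)
    rw [dvd_iff_isRoot, IsRoot.def] at h1
    simp only [eval_sub, eval_pow, eval_X, ZMod.pow_card] at h1
    exact (sub_eq_zero.1 h1).symm
  have hderiv : ∀ b ∈ A, (X - C b) ^ (n - 1) ∣ derivative rem := by
    intro b hb
    have h1 := pow_sub_one_dvd_derivative_of_pow_dvd (hpow b hb)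
    simpa [derivative_X_pow] using h1
  have hmain : F0 ∣ (X - rem) * derivative rem := by
    rw [hF0eq]
    apply Finset.prod_dvd_of_coprime
    · intro b hb b' hb' hne
      apply IsCoprime.pow
      apply isCoprime_X_sub_C_of_isUnit_sub
      rw [isUnit_iff_ne_zero, sub_ne_zero]
      exact hne
    · intro b hb
      have : (X - C b) ^ n = (X - C b) * (X - C b) ^ (n - 1) := by
        rw [← pow_succ']; congr 1; omega
      rw [this]
      apply mul_dvd_mul _ (hderiv b hb)
      rw [dvd_iff_isRoot, IsRoot.def]
      simp [hev b hb]
  obtain ⟨a, ha, b, hb, hab⟩ := Finset.one_lt_card.1 (show 1 < A.card by omega)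
  have hne2 : derivative rem ≠ 0 := by
    intro h0
    have hlt : rem.natDegree < p := by
      have h3 : rem.degree < F0.degree := by
        rw [hrem, hspec 0, ← hF0]; exact degree_modByMonic_lt _ hF0m
      rw [degree_eq_natDegree hF0m.ne_zero, hF0d] at h3
      have h4 : rem.natDegree < n ^ 2 := by
        by_cases hr0 : rem = 0
        · rw [hr0, natDegree_zero]; omega
        · exact (natDegree_lt_iff_degree_lt hr0).2 h3
      omega
    have hconst : rem.natDegree = 0 := by
      by_contra hpos
      have h3 := congrArg (fun f => coeff f (rem.natDegree - 1)) h0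
      simp only [coeff_derivative, coeff_zero] at h3
      have h4 : rem.natDegree - 1 + 1 = rem.natDegree := by omega
      rw [h4] at h3
      have h5 : ((rem.natDegree - 1 : ℕ) : ZMod p) + 1 = (rem.natDegree : ZMod p) := by
        rw [← Nat.cast_one (R := ZMod p), ← Nat.cast_add, h4]
      rw [h5, mul_eq_zero] at h3
      rcases h3 with h3 | h3
      · rw [coeff_natDegree, leadingCoeff_eq_zero] at h3
        rw [h3] at hpos; simp at hpos
      · rw [ZMod.natCast_eq_zero_iff] at h3
        exact absurd (Nat.le_of_dvd (by omega) h3) (by omega)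
    rw [natDegree_eq_zero] at hconst
    obtain ⟨c, hc⟩ := hconst
    have h1 := hev a ha
    have h2 := hev b hb
    rw [← hc, eval_C] at h1 h2
    exact hab (h1.symm.trans h2)
  have hne1 : X - rem ≠ 0 := by
    intro h0
    have : rem = X := (sub_eq_zero.1 h0).symm
    have h1 := hderiv a ha
    rw [this, derivative_X] at h1
    have h3 := natDegree_le_of_dvd h1 one_ne_zero
    rw [natDegree_pow, natDegree_X_sub_C, natDegree_one] at h3
    omega
  have hfin := natDegree_le_of_dvd hmain (mul_ne_zero hne1 hne2)
  rw [natDegree_mul hne1 hne2, hF0d] at hfin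
  have e1 : (X - rem).natDegree ≤ (dirs A).card := by
    refine (natDegree_sub_le _ _).trans ?_
    rw [natDegree_X]; omega
  have e2 := natDegree_derivative_le rem
  omega

end CubeExp

namespace CubeExp

section General
open scoped Pointwise

lemma cs_card {α β : Type*} [DecidableEq α] [DecidableEq β] (X : Finset α) (f : α → β)
    (Q : Finset β) (hQ : ∀ x ∈ X, f x ∈ Q) :
    X.card ^ 2 ≤ Q.card * ((X ×ˢ X).filter (fun q => f q.1 = f q.2)).card := by
  have h1 : X.card = ∑ y ∈ Q, (X.filter (fun x => f x = y)).card :=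
    card_eq_sum_card_fiberwise hQ
  have h2 : ((X ×ˢ X).filter (fun q => f q.1 = f q.2)).card
      = ∑ y ∈ Q, ((X.filter (fun x => f x = y)).card) ^ 2 := by
    rw [card_eq_sum_card_fiberwise (f := fun q => f q.1) (t := Q)]
    · refine sum_congr rfl fun y _ => ?_
      rw [sq, ← card_product]
      congr 1
      ext ⟨a, b⟩
      simp only [mem_filter, mem_product]
      constructor
      · rintro ⟨⟨⟨h1, h2⟩, h3⟩, h4⟩
        exact ⟨⟨h1, h4⟩, h2, h3 ▸ h4⟩
      · rintro ⟨⟨h1, h4⟩, h2, h3⟩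
        exact ⟨⟨⟨h1, h2⟩, h4.trans h3.symm⟩, h4⟩
    · intro q hq
      simp only [coe_filter, mem_product, Set.mem_ofPred_eq] at hq
      exact hQ _ hq.1.1
  rw [h2, h1]
  exact sq_sum_le_card_mul_sum_sq

variable {F : Type*} [Field F] [DecidableEq F]

/-- The number of solutions of `ξ (f x - f u) = g y - g v`. -/
def NN (X : Finset F) (f g : F → F) (ξ : F) : ℕ :=
  (((X ×ˢ X) ×ˢ (X ×ˢ X)).filter
    (fun q => ξ * (f q.1.1 - f q.1.2) = g q.2.1 - g q.2.2)).card

/-- The number of collisions of `f`. -/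
def coll (X : Finset F) (f : F → F) : ℕ :=
  ((X ×ˢ X).filter (fun q => f q.1 = f q.2)).card

lemma sum_NN_le (X : Finset F) (f g : F → F) (Ξ : Finset F) :
    ∑ ξ ∈ Ξ, NN X f g ξ ≤ X.card ^ 4 + coll X f * coll X g * Ξ.card := by
  unfold NN
  simp_rw [card_filter]
  rw [sum_comm]
  have key : ∀ q ∈ (X ×ˢ X) ×ˢ (X ×ˢ X),
      (∑ ξ ∈ Ξ, if ξ * (f q.1.1 - f q.1.2) = g q.2.1 - g q.2.2 then 1 else 0)
      ≤ 1 + (if f q.1.1 = f q.1.2 ∧ g q.2.1 = g q.2.2 then Ξ.card else 0) := by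
    intro q _
    by_cases hu : f q.1.1 - f q.1.2 = 0
    · by_cases hv : g q.2.1 - g q.2.2 = 0
      · rw [if_pos ⟨sub_eq_zero.1 hu, sub_eq_zero.1 hv⟩]
        simp [hu, hv]
      · rw [sum_eq_zero]
        · omega
        · intro ξ _
          rw [if_neg]
          rw [hu, mul_zero]
          exact fun h => hv h.symm
    · rw [← card_filter]
      refine le_trans ?_ (Nat.le_add_right _ _)
      rw [card_le_one]
      intro a ha b hb
      simp only [mem_filter] at ha hb
      exact mul_right_cancel₀ hu (ha.2.trans hb.2.symm)
  refine (sum_le_sum key).trans ?_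
  rw [sum_add_distrib]
  refine add_le_add ?_ ?_
  · simp [card_product]
    apply le_of_eq; ring
  · rw [← sum_filter, sum_const, smul_eq_mul]
    refine Nat.mul_le_mul_right _ ?_
    unfold coll
    rw [← card_product]
    apply card_le_card
    intro q hq
    simp only [mem_filter, mem_product] at hq ⊢
    tauto

lemma coll_id (X : Finset F) : coll X (fun x => x) = X.card := by
  unfold coll
  rw [← diag_card X]
  congr 1
  ext ⟨a, b⟩
  simp only [mem_filter, mem_product, mem_diag]
  constructor
  · rintro ⟨⟨h1, h2⟩, h3⟩; exact ⟨h1, h3⟩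
  · rintro ⟨h1, h3⟩; exact ⟨⟨h1, h3 ▸ h1⟩, h3⟩

lemma coll_sq (X : Finset F) (h2 : (2 : F) ≠ 0) (σ : F) :
    coll X (fun x => (2 * x - σ) ^ 2) ≤ 2 * X.card := by
  unfold coll
  have : ((X ×ˢ X).filter (fun q : F × F => (2 * q.1 - σ) ^ 2 = (2 * q.2 - σ) ^ 2)) ⊆
      X.image (fun x => (x, x)) ∪ X.image (fun x => (x, σ - x)) := by
    rintro ⟨a, b⟩ h
    simp only [mem_filter, mem_product, mem_union, mem_image, Prod.mk.injEq] at h ⊢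
    obtain ⟨⟨ha, hb⟩, h⟩ := h
    rcases sq_eq_sq_iff_eq_or_eq_neg.1 h with h | h
    · left
      refine ⟨a, ha, rfl, ?_⟩
      exact mul_left_cancel₀ h2 (by linear_combination h)
    · right
      refine ⟨a, ha, rfl, ?_⟩
      exact mul_left_cancel₀ h2 (by linear_combination -h)
  refine (card_le_card this).trans ((card_union_le _ _).trans ?_)
  have e1 := card_image_le (s := X) (f := fun x => (x, x))
  have e2 := card_image_le (s := X) (f := fun x => (x, σ - x))
  omega

/-- averaging -/
lemma averaging (X : Finset F) (h2 : (2 : F) ≠ 0) (Ξ M : Finset F) (M1 M2 : F → Finset F)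
    (μ W : ℝ) (hμ : 0 ≤ μ) (hW : 0 ≤ W)
    (hM1 : ∀ ξ ∈ Ξ, M1 ξ ⊆ M ∧ μ ≤ (M1 ξ).card)
    (hM2 : ∀ ξ ∈ Ξ, M2 ξ ⊆ M ∧ μ ≤ (M2 ξ).card)
    (hN : ∀ ξ ∈ Ξ, ∀ σ ∈ M1 ξ, ∀ τ ∈ M2 ξ,
      W ≤ NN X (fun x => (2 * x - σ) ^ 2) (fun x => (2 * x - τ) ^ 2) ξ) :
    Ξ.card * μ ^ 2 * W ≤ (M.card : ℝ) ^ 2 * ((X.card : ℝ) ^ 4 + 4 * X.card ^ 2 * Ξ.card) := by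
  set N : F → F → F → ℝ := fun ξ σ τ =>
    (NN X (fun x => (2 * x - σ) ^ 2) (fun x => (2 * x - τ) ^ 2) ξ : ℝ) with hNdef
  have up : ∀ σ τ, ∑ ξ ∈ Ξ, N ξ σ τ ≤ (X.card : ℝ) ^ 4 + 4 * X.card ^ 2 * Ξ.card := by
    intro σ τ
    have h := sum_NN_le X (fun x => (2 * x - σ) ^ 2) (fun x => (2 * x - τ) ^ 2) Ξ
    have h3 := Nat.mul_le_mul (coll_sq X h2 σ) (coll_sq X h2 τ)
    have h4 : ∑ ξ ∈ Ξ, NN X (fun x => (2 * x - σ) ^ 2) (fun x => (2 * x - τ) ^ 2) ξ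
      ≤ X.card ^ 4 + 4 * X.card ^ 2 * Ξ.card := by
      refine h.trans ?_
      have := Nat.mul_le_mul_right Ξ.card h3
      nlinarith
    simp only [hNdef]
    exact_mod_cast h4
  have lo : ∀ ξ ∈ Ξ, μ ^ 2 * W ≤ ∑ σ ∈ M, ∑ τ ∈ M, N ξ σ τ := by
    intro ξ hξ
    have a1 : ∑ σ ∈ M1 ξ, ∑ τ ∈ M2 ξ, W ≤ ∑ σ ∈ M, ∑ τ ∈ M, N ξ σ τ := by
      calc ∑ σ ∈ M1 ξ, ∑ τ ∈ M2 ξ, W ≤ ∑ σ ∈ M1 ξ, ∑ τ ∈ M2 ξ, N ξ σ τ :=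
            sum_le_sum fun σ hσ => sum_le_sum fun τ hτ => hN ξ hξ σ hσ τ hτ
        _ ≤ ∑ σ ∈ M1 ξ, ∑ τ ∈ M, N ξ σ τ :=
            sum_le_sum fun σ hσ => sum_le_sum_of_subset_of_nonneg (hM2 ξ hξ).1
              fun _ _ _ => Nat.cast_nonneg _
        _ ≤ _ := sum_le_sum_of_subset_of_nonneg (hM1 ξ hξ).1
              fun _ _ _ => sum_nonneg fun _ _ => Nat.cast_nonneg _
    refine le_trans ?_ a1
    simp only [sum_const, nsmul_eq_mul]
    rw [← mul_assoc, sq]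
    exact mul_le_mul_of_nonneg_right
      (mul_le_mul (hM1 ξ hξ).2 (hM2 ξ hξ).2 hμ (Nat.cast_nonneg _)) hW
  calc Ξ.card * μ ^ 2 * W = ∑ ξ ∈ Ξ, μ ^ 2 * W := by
        rw [sum_const, nsmul_eq_mul, mul_assoc]
    _ ≤ ∑ ξ ∈ Ξ, ∑ σ ∈ M, ∑ τ ∈ M, N ξ σ τ := sum_le_sum lo
    _ = ∑ σ ∈ M, ∑ τ ∈ M, ∑ ξ ∈ Ξ, N ξ σ τ := by
        rw [sum_comm]
        refine sum_congr rfl fun σ _ => ?_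
        rw [sum_comm]
    _ ≤ ∑ σ ∈ M, ∑ τ ∈ M, ((X.card : ℝ) ^ 4 + 4 * X.card ^ 2 * Ξ.card) :=
        sum_le_sum fun σ _ => sum_le_sum fun τ _ => up σ τ
    _ = _ := by
        simp only [sum_const, nsmul_eq_mul]; ring

/-- Plünnecke in the form used here -/
lemma plu_diff (A : Finset F) (hA : A.Nonempty) (m n : ℕ) :
    ((m • A - n • A).card : ℝ) * (A.card : ℝ) ^ (m + n) ≤ ((A - A).card : ℝ) ^ (m + n) * A.card := by
  have h := pluennecke_ruzsa_inequality_nsmul_sub_nsmul_sub hA A m n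
  have hpos : (0 : ℚ≥0) < (A.card : ℚ≥0) := by exact_mod_cast hA.card_pos
  have h3 : ((m • A - n • A).card : ℚ≥0) * (A.card : ℚ≥0) ^ (m + n)
      ≤ ((A - A).card : ℚ≥0) ^ (m + n) * A.card := by
    calc _ ≤ ((A - A).card / A.card : ℚ≥0) ^ (m + n) * A.card * (A.card : ℚ≥0) ^ (m + n) := by
          gcongr
      _ = _ := by rw [div_pow]; field_simp
  exact_mod_cast h3

lemma plu_sum (B : Finset F) (hB : B.Nonempty) (n : ℕ) :
    ((n • B).card : ℝ) * (B.card : ℝ) ^ n ≤ ((B + B).card : ℝ) ^ n * B.card := by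
  have h := pluennecke_ruzsa_inequality_nsmul_add hB B n
  have hpos : (0 : ℚ≥0) < (B.card : ℚ≥0) := by exact_mod_cast hB.card_pos
  have h3 : ((n • B).card : ℚ≥0) * (B.card : ℚ≥0) ^ n
      ≤ ((B + B).card : ℚ≥0) ^ n * B.card := by
    calc _ ≤ ((B + B).card / B.card : ℚ≥0) ^ n * B.card * (B.card : ℚ≥0) ^ n := by
          gcongr
      _ = _ := by rw [div_pow]; field_simp
  exact_mod_cast h3

lemma exists_four (B : Finset F) (hB : B.Nonempty) : ∃ Q : Finset F,
    (∀ a ∈ B, ∀ b ∈ B, ∀ c ∈ B, ∀ d ∈ B, a + b + c + d ∈ Q) ∧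
    (Q.card : ℝ) * (B.card : ℝ) ^ 3 ≤ ((B + B).card : ℝ) ^ 4 := by
  refine ⟨4 • B, ?_, ?_⟩
  · intro a ha b hb c hc d hd
    have : 4 • B = B + B + B + B := by
      rw [show (4 : ℕ) = 1 + 1 + 1 + 1 from rfl, add_nsmul, add_nsmul, add_nsmul, one_nsmul]
    rw [this]
    exact add_mem_add (add_mem_add (add_mem_add ha hb) hc) hd
  · have h := plu_sum B hB 4
    have hpos : (0 : ℝ) < (B.card : ℝ) := by exact_mod_cast hB.card_pos
    refine le_of_mul_le_mul_right ?_ hpos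
    linarith [show ((4 • B).card : ℝ) * (B.card : ℝ) ^ 3 * B.card
      = ((4 • B).card : ℝ) * (B.card : ℝ) ^ 4 by ring]

lemma exists_eight (B : Finset F) (hB : B.Nonempty) : ∃ Q Q4 : Finset F,
    (∀ a ∈ B, ∀ b ∈ B, ∀ c ∈ B, ∀ d ∈ B, a + b + c + d ∈ Q4) ∧
    (∀ a ∈ Q4, ∀ b ∈ Q4, a + b ∈ Q) ∧
    (Q.card : ℝ) * (B.card : ℝ) ^ 7 ≤ ((B + B).card : ℝ) ^ 8 := by
  refine ⟨8 • B, 4 • B, ?_, ?_, ?_⟩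
  · intro a ha b hb c hc d hd
    have : 4 • B = B + B + B + B := by
      rw [show (4 : ℕ) = 1 + 1 + 1 + 1 from rfl, add_nsmul, add_nsmul, add_nsmul, one_nsmul]
    rw [this]
    exact add_mem_add (add_mem_add (add_mem_add ha hb) hc) hd
  · intro a ha b hb
    rw [show (8 : ℕ) = 4 + 4 from rfl, add_nsmul]
    exact add_mem_add ha hb
  · have h := plu_sum B hB 8
    have hpos : (0 : ℝ) < (B.card : ℝ) := by exact_mod_cast hB.card_pos
    refine le_of_mul_le_mul_right ?_ hpos
    linarith [show ((8 • B).card : ℝ) * (B.card : ℝ) ^ 7 * B.card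
      = ((8 • B).card : ℝ) * (B.card : ℝ) ^ 8 by ring]

lemma exists_M6 (A : Finset F) (hA : A.Nonempty) : ∃ M : Finset F,
    (∀ a ∈ A, ∀ b ∈ A, ∀ y ∈ A - A, a + b + 2 * y ∈ M) ∧
    (M.card : ℝ) * (A.card : ℝ) ^ 5 ≤ ((A - A).card : ℝ) ^ 6 := by
  refine ⟨4 • A - 2 • A, ?_, ?_⟩
  · intro a ha b hb y hy
    obtain ⟨c, hc, d, hd, rfl⟩ := mem_sub.1 hy
    have e4 : 4 • A = A + A + A + A := by
      rw [show (4 : ℕ) = 1 + 1 + 1 + 1 from rfl, add_nsmul, add_nsmul, add_nsmul, one_nsmul]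
    have e2 : 2 • A = A + A := by
      rw [show (2 : ℕ) = 1 + 1 from rfl, add_nsmul, one_nsmul]
    rw [e4, e2, show a + b + 2 * (c - d) = (a + b + c + c) - (d + d) by ring]
    exact sub_mem_sub (add_mem_add (add_mem_add (add_mem_add ha hb) hc) hc) (add_mem_add hd hd)
  · have h := plu_diff A hA 4 2
    have hpos : (0 : ℝ) < (A.card : ℝ) := by exact_mod_cast hA.card_pos
    refine le_of_mul_le_mul_right ?_ hpos
    norm_num at h
    linarith [show ((4 • A - 2 • A).card : ℝ) * (A.card : ℝ) ^ 5 * A.card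
      = ((4 • A - 2 • A).card : ℝ) * (A.card : ℝ) ^ 6 by ring]

lemma exists_M2 (A : Finset F) : ∃ M : Finset F,
    (∀ a ∈ A, ∀ b ∈ A, a + b ∈ M) ∧
    (M.card : ℝ) * (A.card : ℝ) ≤ ((A - A).card : ℝ) ^ 2 := by
  refine ⟨A + A, fun a ha b hb => add_mem_add ha hb, ?_⟩
  have h := ruzsa_triangle_inequality_add_sub_sub A A A
  rw [sq]
  exact_mod_cast h

end General
end CubeExp

namespace CubeExp
section Embed
open scoped Pointwise
variable {F : Type*} [Field F] [DecidableEq F]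

/-- the cubes of differences -/
def cubes (A : Finset F) : Finset F := (A - A).image (fun x => x ^ 3)

lemma cube_mem {A : Finset F} {a b : F} (ha : a ∈ A) (hb : b ∈ A) : (a - b) ^ 3 ∈ cubes A :=
  mem_image_of_mem (fun x : F => x ^ 3) (sub_mem_sub ha hb)

lemma cubes_card (A : Finset F) : (A - A).card ≤ 3 * (cubes A).card := by
  unfold cubes
  refine card_le_mul_card_image (A - A) 3 ?_
  intro y _
  have h : (A - A).filter (fun x => x ^ 3 = y) ⊆ (Polynomial.nthRoots 3 y).toFinset := by
    intro x hx
    simp only [mem_filter] at hx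
    rw [Multiset.mem_toFinset, Polynomial.mem_nthRoots (by norm_num)]
    exact hx.2
  exact (card_le_card h).trans ((Multiset.toFinset_card_le _).trans (Polynomial.card_nthRoots 3 y))

/-- elements of `A` that stay in `A` when translated by `-y` -/
def sh (A : Finset F) (y : F) : Finset F := A.filter (fun x => x - y ∈ A)

lemma quad_embed (A : Finset F) (h3 : (3 : F) ≠ 0) (Q : Finset F)
    (hQ : ∀ a ∈ cubes A, ∀ b ∈ cubes A, ∀ c ∈ cubes A, ∀ d ∈ cubes A, a + b + c + d ∈ Q)
    {a a' b b' : F} (ha : a ∈ A) (ha' : a' ∈ A) (hb : b ∈ A) (hb' : b' ∈ A) (y z ξ : F)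
    (hξ : a - a' = ξ * (b - b')) (hne : b ≠ b') :
    ((sh A y).card * (sh A z).card) ^ 2 ≤ Q.card *
      NN A (fun x => (2 * x - (a + a' + 2 * y)) ^ 2) (fun x => (2 * x - (b + b' + 2 * z)) ^ 2) ξ := by
  rw [← card_product]
  refine (cs_card (sh A y ×ˢ sh A z)
    (fun x => (a - (x.1 - y)) ^ 3 + ((x.1 - y) - a') ^ 3 + (b - (x.2 - z)) ^ 3
      + ((x.2 - z) - b') ^ 3) Q ?_).trans ?_
  · rintro ⟨x, w⟩ hx
    simp only [sh, mem_product, mem_filter] at hx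
    obtain ⟨⟨_, hx⟩, _, hw⟩ := hx
    exact hQ _ (cube_mem ha hx) _ (cube_mem hx ha') _ (cube_mem hb hw) _ (cube_mem hw hb')
  · refine Nat.mul_le_mul_left _ ?_
    unfold NN
    refine card_le_card_of_injOn (fun q => ((q.1.1, q.2.1), (q.2.2, q.1.2))) ?_ ?_
    · rintro ⟨⟨x, w⟩, ⟨x', w'⟩⟩ h
      simp only [coe_filter, sh, mem_product, mem_filter, Set.mem_ofPred_eq] at h ⊢
      obtain ⟨⟨⟨⟨h1, _⟩, h2, _⟩, ⟨h5, _⟩, h4, _⟩, h⟩ := h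
      refine ⟨⟨⟨h1, h5⟩, h4, h2⟩, ?_⟩
      have hn : 3 * (b - b') ≠ 0 := mul_ne_zero h3 (sub_ne_zero.2 hne)
      refine mul_left_cancel₀ hn ?_
      linear_combination 4 * h - 3 * ((2 * x - (a + a' + 2 * y)) ^ 2
        - (2 * x' - (a + a' + 2 * y)) ^ 2) * hξ
    · rintro ⟨⟨x, w⟩, ⟨x', w'⟩⟩ _ ⟨⟨u, v⟩, ⟨u', v'⟩⟩ _ h
      simp only [Prod.mk.injEq] at h ⊢
      tauto

lemma lin_embed (A : Finset F) (h2 : (2 : F) ≠ 0) (h3 : (3 : F) ≠ 0) (Q Q4 : Finset F)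
    (hQ4 : ∀ a ∈ cubes A, ∀ b ∈ cubes A, ∀ c ∈ cubes A, ∀ d ∈ cubes A, a + b + c + d ∈ Q4)
    (hQ : ∀ a ∈ Q4, ∀ b ∈ Q4, a + b ∈ Q)
    {a a' b b' : F} (ha : a ∈ A) (ha' : a' ∈ A) (hb : b ∈ A) (hb' : b' ∈ A) (δ ξ : F)
    (hδ : δ ≠ 0) (hξ : a - a' = ξ * (b - b')) (hne : b ≠ b') :
    ((sh A δ).card * (sh A δ).card) ^ 2 ≤ Q.card *
      NN (sh A δ) (fun x => x) (fun x => x) ξ := by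
  rw [← card_product]
  refine (cs_card (sh A δ ×ˢ sh A δ)
    (fun x => ((a - x.1) ^ 3 + (x.1 - a') ^ 3 + (x.1 - δ - a) ^ 3 + (a' - (x.1 - δ)) ^ 3)
      + ((b - x.2) ^ 3 + (x.2 - b') ^ 3 + (x.2 - δ - b) ^ 3 + (b' - (x.2 - δ)) ^ 3)) Q ?_).trans ?_
  · rintro ⟨x, w⟩ hx
    simp only [sh, mem_product, mem_filter] at hx
    obtain ⟨⟨hx, hx'⟩, hw, hw'⟩ := hx
    exact hQ _ (hQ4 _ (cube_mem ha hx) _ (cube_mem hx ha') _ (cube_mem hx' ha) _ (cube_mem ha' hx'))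
      _ (hQ4 _ (cube_mem hb hw) _ (cube_mem hw hb') _ (cube_mem hw' hb) _ (cube_mem hb' hw'))
  · refine Nat.mul_le_mul_left _ ?_
    unfold NN
    refine card_le_card_of_injOn (fun q => ((q.1.1, q.2.1), (q.2.2, q.1.2))) ?_ ?_
    · rintro ⟨⟨x, w⟩, ⟨x', w'⟩⟩ h
      simp only [coe_filter, mem_product, mem_filter, Set.mem_ofPred_eq] at h ⊢
      obtain ⟨⟨⟨h1, h2'⟩, h3', h4⟩, h⟩ := h
      refine ⟨⟨⟨h1, h3'⟩, h4, h2'⟩, ?_⟩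
      have hn : 2 * 3 * δ * (b - b') ≠ 0 :=
        mul_ne_zero (mul_ne_zero (mul_ne_zero h2 h3) hδ) (sub_ne_zero.2 hne)
      refine mul_left_cancel₀ hn ?_
      linear_combination h - 6 * δ * (x - x') * hξ
    · rintro ⟨⟨x, w⟩, ⟨x', w'⟩⟩ _ ⟨⟨u, v⟩, ⟨u', v'⟩⟩ _ h
      simp only [Prod.mk.injEq] at h ⊢
      tauto

/-- the general quadratic bound -/
lemma quad_general (A : Finset F) (h2 : (2 : F) ≠ 0) (h3 : (3 : F) ≠ 0) (hA : A.Nonempty)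
    (Ξ M : Finset F) (M1 M2 : F → Finset F)
    (μ u : ℝ) (hμ : 0 ≤ μ) (hu : 0 ≤ u)
    (hM1 : ∀ ξ ∈ Ξ, M1 ξ ⊆ M ∧ μ ≤ (M1 ξ).card)
    (hM2 : ∀ ξ ∈ Ξ, M2 ξ ⊆ M ∧ μ ≤ (M2 ξ).card)
    (hN : ∀ ξ ∈ Ξ, ∀ σ ∈ M1 ξ, ∀ τ ∈ M2 ξ, ∃ a ∈ A, ∃ a' ∈ A, ∃ b ∈ A, ∃ b' ∈ A, ∃ y z : F,
      a - a' = ξ * (b - b') ∧ b ≠ b' ∧ σ = a + a' + 2 * y ∧ τ = b + b' + 2 * z ∧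
      u ≤ (sh A y).card ∧ u ≤ (sh A z).card) :
    Ξ.card * μ ^ 2 * u ^ 4 * ((A - A).card : ℝ) ^ 3 ≤
      27 * ((cubes A + cubes A).card : ℝ) ^ 4 *
      ((M.card : ℝ) ^ 2 * ((A.card : ℝ) ^ 4 + 4 * A.card ^ 2 * Ξ.card)) := by
  have hB : (cubes A).Nonempty := by
    obtain ⟨a, ha⟩ := hA
    exact ⟨_, cube_mem ha ha⟩
  obtain ⟨Q, hQ, hQc⟩ := exists_four (cubes A) hB
  have hQpos : (0 : ℝ) < Q.card := by
    obtain ⟨b, hb⟩ := hB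
    exact_mod_cast card_pos.2 ⟨_, hQ b hb b hb b hb b hb⟩
  have key := averaging A h2 Ξ M M1 M2 μ (u ^ 4 / Q.card) hμ (by positivity) hM1 hM2 (by
    intro ξ hξ σ hσ τ hτ
    obtain ⟨a, ha, a', ha', b, hb, b', hb', y, z, e, hne, rfl, rfl, hy, hz⟩ := hN ξ hξ σ hσ τ hτ
    have h := quad_embed A h3 Q hQ ha ha' hb hb' y z ξ e hne
    rw [div_le_iff₀ hQpos, mul_comm]
    have h' : (((sh A y).card : ℝ) * (sh A z).card) ^ 2 ≤ Q.card *
      NN A (fun x => (2 * x - (a + a' + 2 * y)) ^ 2)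
        (fun x => (2 * x - (b + b' + 2 * z)) ^ 2) ξ := by exact_mod_cast h
    refine le_trans ?_ h'
    calc u ^ 4 = (u * u) ^ 2 := by ring
      _ ≤ _ := by gcongr)
  have hD : ((A - A).card : ℝ) ≤ 3 * (cubes A).card := by exact_mod_cast cubes_card A
  set T : ℝ := (M.card : ℝ) ^ 2 * ((A.card : ℝ) ^ 4 + 4 * A.card ^ 2 * Ξ.card) with hT
  have hT0 : 0 ≤ T := by positivity
  have k2 : Ξ.card * μ ^ 2 * u ^ 4 ≤ Q.card * T := by
    have : Ξ.card * μ ^ 2 * u ^ 4 = Q.card * (Ξ.card * μ ^ 2 * (u ^ 4 / Q.card)) := by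
      field_simp
    rw [this]; gcongr
  calc Ξ.card * μ ^ 2 * u ^ 4 * ((A - A).card : ℝ) ^ 3
      ≤ Q.card * T * (3 * (cubes A).card) ^ 3 := by gcongr
    _ = 27 * (Q.card * ((cubes A).card : ℝ) ^ 3) * T := by ring
    _ ≤ _ := by gcongr

/-- the general linear bound -/
lemma lin_general (A : Finset F) (h2 : (2 : F) ≠ 0) (h3 : (3 : F) ≠ 0) (hA : A.Nonempty)
    (Ξ : Finset F) (δ : F) (hδ : δ ≠ 0)
    (hN : ∀ ξ ∈ Ξ, ∃ a ∈ A, ∃ a' ∈ A, ∃ b ∈ A, ∃ b' ∈ A, a - a' = ξ * (b - b') ∧ b ≠ b') :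
    Ξ.card * ((sh A δ).card : ℝ) ^ 4 * ((A - A).card : ℝ) ^ 7 ≤
      3 ^ 7 * ((cubes A + cubes A).card : ℝ) ^ 8 *
      (((sh A δ).card : ℝ) ^ 4 + (sh A δ).card ^ 2 * Ξ.card) := by
  have hB : (cubes A).Nonempty := by
    obtain ⟨a, ha⟩ := hA
    exact ⟨_, cube_mem ha ha⟩
  obtain ⟨Q, Q4, hQ4, hQ, hQc⟩ := exists_eight (cubes A) hB
  have hD : ((A - A).card : ℝ) ≤ 3 * (cubes A).card := by exact_mod_cast cubes_card A
  have h := sum_NN_le (sh A δ) (fun x => x) (fun x => x) Ξ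
  rw [coll_id] at h
  have h' : (∑ ξ ∈ Ξ, (NN (sh A δ) (fun x => x) (fun x => x) ξ : ℝ))
      ≤ ((sh A δ).card : ℝ) ^ 4 + (sh A δ).card * (sh A δ).card * Ξ.card := by exact_mod_cast h
  rw [← sq] at h'
  set T : ℝ := ((sh A δ).card : ℝ) ^ 4 + (sh A δ).card ^ 2 * Ξ.card with hT
  have hT0 : 0 ≤ T := by positivity
  have k2 : Ξ.card * ((sh A δ).card : ℝ) ^ 4 ≤ Q.card * T := by
    calc Ξ.card * ((sh A δ).card : ℝ) ^ 4 = ∑ ξ ∈ Ξ, ((sh A δ).card : ℝ) ^ 4 := by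
          rw [sum_const, nsmul_eq_mul]
      _ ≤ ∑ ξ ∈ Ξ, Q.card * (NN (sh A δ) (fun x => x) (fun x => x) ξ : ℝ) := by
          refine sum_le_sum fun ξ hξ => ?_
          obtain ⟨a, ha, a', ha', b, hb, b', hb', e, hne⟩ := hN ξ hξ
          have h := lin_embed A h2 h3 Q Q4 hQ4 hQ ha ha' hb hb' δ ξ hδ e hne
          have h' : (((sh A δ).card : ℝ) * (sh A δ).card) ^ 2 ≤ Q.card *
            NN (sh A δ) (fun x => x) (fun x => x) ξ := by exact_mod_cast h
          calc ((sh A δ).card : ℝ) ^ 4 = (((sh A δ).card : ℝ) * (sh A δ).card) ^ 2 := by ring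
            _ ≤ _ := h'
      _ = Q.card * ∑ ξ ∈ Ξ, (NN (sh A δ) (fun x => x) (fun x => x) ξ : ℝ) := by rw [mul_sum]
      _ ≤ _ := by gcongr
  calc Ξ.card * ((sh A δ).card : ℝ) ^ 4 * ((A - A).card : ℝ) ^ 7
      ≤ Q.card * T * (3 * (cubes A).card) ^ 7 := by gcongr
    _ = 3 ^ 7 * (Q.card * ((cubes A).card : ℝ) ^ 7) * T := by ring
    _ ≤ _ := by gcongr

/-- representation counts sum to `n ^ 2` -/
lemma sum_sh (A : Finset F) : ∑ t ∈ A - A, (sh A t).card = A.card ^ 2 := by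
  have h := card_eq_sum_card_fiberwise (s := A ×ˢ A) (t := A - A) (f := fun q => q.1 - q.2) (by
    intro q hq
    simp only [coe_product, Set.mem_prod, mem_coe] at hq
    exact sub_mem_sub hq.1 hq.2)
  rw [sq, ← card_product, h]
  refine sum_congr rfl fun t _ => ?_
  unfold sh
  refine card_bij (fun x _ => (x, x - t)) ?_ ?_ ?_
  · intro x hx
    simp only [mem_filter, mem_product] at hx ⊢
    exact ⟨hx, by ring⟩
  · intro x _ y _ h
    simp only [Prod.mk.injEq] at h
    exact h.1
  · rintro ⟨x, y⟩ h
    simp only [mem_filter, mem_product] at h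
    refine ⟨x, ?_, ?_⟩
    · simp only [mem_filter]
      refine ⟨h.1.1, ?_⟩
      rw [← h.2]; simpa using h.1.2
    · rw [← h.2]; simp

end Embed
end CubeExp

namespace CubeExp
section RegimeI
open scoped Pointwise

lemma popular {F : Type*} [Field F] [DecidableEq F] (A : Finset F) (hA : A.Nonempty) :
    ∃ Y ⊆ A - A, (A.card : ℝ) / 2 ≤ Y.card ∧
      ∀ y ∈ Y, (A.card : ℝ) ^ 2 / (2 * (A - A).card) ≤ (sh A y).card := by
  classical
  set n : ℝ := (A.card : ℝ) with hn
  have hn0 : 0 < n := by rw [hn]; exact_mod_cast hA.card_pos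
  have hD0 : (0 : ℝ) < (A - A).card := by exact_mod_cast (hA.sub hA).card_pos
  set u : ℝ := n ^ 2 / (2 * (A - A).card) with hu
  refine ⟨(A - A).filter (fun y => u ≤ (sh A y).card), filter_subset _ _, ?_, ?_⟩
  · have h : ∑ t ∈ A - A, ((sh A t).card : ℝ) = n ^ 2 := by rw [hn]; exact_mod_cast sum_sh A
    rw [← sum_filter_add_sum_filter_not (A - A) (fun y => u ≤ (sh A y).card)] at h
    have h1 : ∑ t ∈ (A - A).filter (fun y => u ≤ (sh A y).card), ((sh A t).card : ℝ)
        ≤ ((A - A).filter (fun y => u ≤ (sh A y).card)).card * n := by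
      rw [← nsmul_eq_mul]
      refine sum_le_card_nsmul _ _ _ fun t _ => ?_
      rw [hn]; exact_mod_cast card_le_card (filter_subset _ _)
    have h2 : ∑ t ∈ (A - A).filter (fun y => ¬ u ≤ (sh A y).card), ((sh A t).card : ℝ)
        ≤ (A - A).card * u := by
      calc _ ≤ ((A - A).filter (fun y => ¬ u ≤ (sh A y).card)).card * u := by
            rw [← nsmul_eq_mul]
            refine sum_le_card_nsmul _ _ _ fun t ht => ?_
            exact (not_le.1 (mem_filter.1 ht).2).le
        _ ≤ _ := by gcongr; exact filter_subset _ _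
    have h3 : (A - A).card * u = n ^ 2 / 2 := by rw [hu]; field_simp
    rw [h3] at h2
    have : n / 2 * n ≤ ((A - A).filter (fun y => u ≤ (sh A y).card)).card * n := by nlinarith
    exact le_of_mul_le_mul_right this hn0
  · intro y hy
    exact (mem_filter.1 hy).2

lemma regimeI {p : ℕ} [Fact p.Prime] (hp3 : 3 < p) (A : Finset (ZMod p)) (h4 : 4 ≤ A.card)
    (hp : A.card ^ 2 ≤ p) :
    (A.card : ℝ) ^ 142 ≤ (4 * 3 ^ 8) ^ 13 * 10368 ^ 5
      * ((cubes A + cubes A).card : ℝ) ^ 124 := by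
  classical
  have hA : A.Nonempty := card_pos.1 (by omega)
  have ne : ∀ k : ℕ, 0 < k → k < p → ((k : ℕ) : ZMod p) ≠ 0 := by
    intro k hk hkp h
    rw [ZMod.natCast_eq_zero_iff] at h
    exact absurd (Nat.le_of_dvd hk h) (by omega)
  have h2 : (2 : ZMod p) ≠ 0 := by exact_mod_cast ne 2 (by norm_num) (by omega)
  have h3 : (3 : ZMod p) ≠ 0 := by exact_mod_cast ne 3 (by norm_num) (by omega)
  obtain ⟨Y, hYD, hYc, hY⟩ := popular A hA
  have hX := szonyi A (by omega) hp
  have hXr : ((A.card : ℝ)) ^ 2 ≤ 2 * (dirs A).card := by exact_mod_cast hX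
  have hrep : ∀ ξ ∈ dirs A, ∃ a ∈ A, ∃ a' ∈ A, ∃ b ∈ A, ∃ b' ∈ A,
      a - a' = ξ * (b - b') ∧ b ≠ b' := by
    intro ξ hξ
    simp only [dirs, mem_filter, mem_product] at hξ
    obtain ⟨_, q, hq, q', hq', hne, e⟩ := hξ
    refine ⟨q.2, hq.2, q'.2, hq'.2, q.1, hq.1, q'.1, hq'.1, by linear_combination e, ?_⟩
    intro h
    apply hne
    refine Prod.ext h ?_
    rw [h] at e
    linear_combination e
  set n : ℝ := (A.card : ℝ) with hn
  set D : ℝ := ((A - A).card : ℝ) with hD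
  set S : ℝ := ((cubes A + cubes A).card : ℝ) with hS
  set X : ℝ := ((dirs A).card : ℝ) with hXd
  have hn4 : 4 ≤ n := by rw [hn]; exact_mod_cast h4
  have hD0 : 0 < D := by rw [hD]; exact_mod_cast (hA.sub hA).card_pos
  have hX0 : 0 < X := by nlinarith
  have hS0 : 0 ≤ S := Nat.cast_nonneg _
  -- linear
  have lin : n ^ 4 * D ^ 5 ≤ 4 * 3 ^ 8 * S ^ 8 := by
    have hY1 : 1 < Y.card := by
      have : (2 : ℝ) ≤ Y.card := by linarith
      have : 2 ≤ Y.card := by exact_mod_cast this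
      omega
    obtain ⟨δ, hδ, hδ0⟩ := exists_mem_ne hY1 0
    have h := lin_general A h2 h3 hA (dirs A) δ hδ0 hrep
    have hr := hY δ hδ
    have hrn : ((sh A δ).card : ℝ) ≤ n := by
      rw [hn]; exact_mod_cast card_le_card (filter_subset _ _)
    rw [div_le_iff₀ (by positivity)] at hr
    set r : ℝ := ((sh A δ).card : ℝ) with hr'
    rw [← hXd, ← hD, ← hS] at h
    have hr0 : 0 < r := by
      by_contra hc
      have : r * (2 * D) ≤ 0 := mul_nonpos_of_nonpos_of_nonneg (not_lt.1 hc) (by positivity)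
      nlinarith
    have hrX : r ^ 2 ≤ 2 * X := le_trans (by gcongr) hXr
    have k1 : X * r ^ 4 * D ^ 7 ≤ 3 ^ 8 * S ^ 8 * (r ^ 2 * X) := by
      refine h.trans ?_
      have : r ^ 4 + r ^ 2 * X ≤ 3 * (r ^ 2 * X) := by nlinarith [sq_nonneg r]
      calc 3 ^ 7 * S ^ 8 * (r ^ 4 + r ^ 2 * X) ≤ 3 ^ 7 * S ^ 8 * (3 * (r ^ 2 * X)) := by gcongr
        _ = _ := by ring
    have k2 : r ^ 2 * D ^ 7 ≤ 3 ^ 8 * S ^ 8 := by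
      refine le_of_mul_le_mul_right (a := r ^ 2 * X) ?_ (by positivity)
      calc _ = X * r ^ 4 * D ^ 7 := by ring
        _ ≤ _ := k1
    calc n ^ 4 * D ^ 5 = (n ^ 2) ^ 2 * D ^ 5 := by ring
      _ ≤ (r * (2 * D)) ^ 2 * D ^ 5 := by gcongr
      _ = 4 * (r ^ 2 * D ^ 7) := by ring
      _ ≤ 4 * (3 ^ 8 * S ^ 8) := by gcongr
      _ = _ := by ring
  have quad : n ^ 18 ≤ 10368 * S ^ 4 * D ^ 13 := by
    obtain ⟨M, hM, hMc⟩ := exists_M6 A hA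
    choose! a ha a' ha' b hb b' hb' e hne using hrep
    have hinj : ∀ s : ZMod p, Function.Injective (fun y => s + 2 * y) := by
      intro s x y h
      exact mul_left_cancel₀ h2 (add_left_cancel h)
    have h := quad_general A h2 h3 hA (dirs A) M
      (fun ξ => Y.image (fun y => a ξ + a' ξ + 2 * y))
      (fun ξ => Y.image (fun y => b ξ + b' ξ + 2 * y)) (n / 2) (n ^ 2 / (2 * D))
      (by positivity) (by positivity)
      (by
        intro ξ hξ
        refine ⟨?_, ?_⟩
        · intro x hx
          obtain ⟨y, hy, rfl⟩ := mem_image.1 hx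
          exact hM _ (ha ξ hξ) _ (ha' ξ hξ) _ (hYD hy)
        · rw [card_image_of_injective _ (hinj _)]; exact hYc)
      (by
        intro ξ hξ
        refine ⟨?_, ?_⟩
        · intro x hx
          obtain ⟨y, hy, rfl⟩ := mem_image.1 hx
          exact hM _ (hb ξ hξ) _ (hb' ξ hξ) _ (hYD hy)
        · rw [card_image_of_injective _ (hinj _)]; exact hYc)
      (by
        intro ξ hξ σ hσ τ hτ
        obtain ⟨y, hy, rfl⟩ := mem_image.1 hσ
        obtain ⟨z, hz, rfl⟩ := mem_image.1 hτ
        exact ⟨a ξ, ha ξ hξ, a' ξ, ha' ξ hξ, b ξ, hb ξ hξ, b' ξ, hb' ξ hξ, y, z, e ξ hξ, hne ξ hξ,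
          rfl, rfl, hY y hy, hY z hz⟩)
    rw [← hXd, ← hD, ← hS, ← hn] at h
    rw [← hn, ← hD] at hMc
    set m : ℝ := (M.card : ℝ) with hm
    have k0 : n ^ 4 + 4 * n ^ 2 * X ≤ 6 * n ^ 2 * X := by nlinarith [sq_nonneg n]
    have k1 : X * (n / 2) ^ 2 * (n ^ 2 / (2 * D)) ^ 4 * D ^ 3
        ≤ 27 * S ^ 4 * (m ^ 2 * (6 * n ^ 2 * X)) := h.trans (by gcongr)
    have k2 : n ^ 8 ≤ 10368 * S ^ 4 * m ^ 2 * D := by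
      refine le_of_mul_le_mul_right (a := X * n ^ 2 / (64 * D)) ?_ (by positivity)
      calc _ = X * (n / 2) ^ 2 * (n ^ 2 / (2 * D)) ^ 4 * D ^ 3 := by field_simp; norm_num
        _ ≤ _ := k1
        _ = _ := by field_simp; ring
    calc n ^ 18 = n ^ 8 * n ^ 10 := by ring
      _ ≤ (10368 * S ^ 4 * m ^ 2 * D) * n ^ 10 := by gcongr
      _ = 10368 * S ^ 4 * D * (m * n ^ 5) ^ 2 := by ring
      _ ≤ 10368 * S ^ 4 * D * (D ^ 6) ^ 2 := by gcongr
      _ = _ := by ring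
  refine le_of_mul_le_mul_right (a := D ^ 65) ?_ (by positivity)
  calc n ^ 142 * D ^ 65 = (n ^ 4 * D ^ 5) ^ 13 * (n ^ 18) ^ 5 := by ring
    _ ≤ (4 * 3 ^ 8 * S ^ 8) ^ 13 * (10368 * S ^ 4 * D ^ 13) ^ 5 := by gcongr
    _ = _ := by ring

end RegimeI
end CubeExp

namespace CubeExp
section CharSum
open scoped Pointwise
variable {F : Type*} [Field F] [DecidableEq F] [Fintype F]

lemma sum_aff (I : F → ℝ) (c d : F) (hc : c ≠ 0) : ∑ b, I (c * b + d) = ∑ b, I b := by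
  have : Function.Bijective (fun b : F => c * b + d) := by
    rw [← Finite.injective_iff_bijective]
    intro x y h
    exact mul_left_cancel₀ hc (add_right_cancel h)
  exact this.sum_comp I

lemma sum_shift (I : F → ℝ) (d : F) : ∑ b, I (b + d) = ∑ b, I b := by
  simpa using sum_aff I 1 d one_ne_zero

lemma sum_sq_h (I : F → ℝ) (hI0 : ∀ x, 0 ≤ I x) (hI1 : ∀ x, I x ≤ 1)
    (h2 : (2 : F) ≠ 0) (h3 : (3 : F) ≠ 0) (a a' : F) (hne : a ≠ a') :
    ∑ y, (∑ b, I (y + ((a - b) ^ 3 - (a' - b) ^ 3))) ^ 2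
      ≤ (∑ x, I x) * ((Fintype.card F) * (∑ x, I x) + Fintype.card F) := by
  classical
  set s := ∑ x, I x with hs
  set Q : F → F := fun b => (a - b) ^ 3 - (a' - b) ^ 3 with hQ
  have inner : ∀ w, ∑ b, ∑ b', I (w + (Q b' - Q b)) ≤ Fintype.card F * s + Fintype.card F := by
    intro w
    calc ∑ b, ∑ b', I (w + (Q b' - Q b)) = ∑ b, ∑ x, I (w + (Q (x + b) - Q b)) := by
          refine sum_congr rfl fun b _ => ?_
          exact (sum_shift (fun b' => I (w + (Q b' - Q b))) b).symm
      _ = ∑ x, ∑ b, I (w + (Q (x + b) - Q b)) := sum_comm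
      _ ≤ ∑ x : F, (s + if x = 0 then (Fintype.card F : ℝ) else 0) := by
          refine sum_le_sum fun x _ => ?_
          by_cases hx : x = 0
          · simp only [hx, zero_add, sub_self, add_zero, sum_const, nsmul_eq_mul, if_true,
              card_univ]
            have : (0 : ℝ) ≤ s := sum_nonneg fun x _ => hI0 x
            have := mul_le_of_le_one_right (Nat.cast_nonneg (α := ℝ) (Fintype.card F)) (hI1 w)
            linarith
          · rw [if_neg hx, add_zero]
            apply le_of_eq
            have hc : 2 * 3 * (a - a') * x ≠ 0 :=
              mul_ne_zero (mul_ne_zero (mul_ne_zero h2 h3) (sub_ne_zero.2 hne)) hx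
            rw [hs, ← sum_aff I (2 * 3 * (a - a') * x) (w + 3 * (a - a') * x * (x - (a + a'))) hc]
            refine sum_congr rfl fun b _ => ?_
            congr 1
            simp only [hQ]
            ring
      _ = _ := by
          rw [sum_add_distrib]
          simp [card_univ]
  calc ∑ y, (∑ b, I (y + Q b)) ^ 2
      = ∑ y, ∑ b, ∑ b', I (y + Q b) * I (y + Q b') := by
        refine sum_congr rfl fun y _ => ?_
        rw [sq, sum_mul_sum]
    _ = ∑ b, ∑ b', ∑ y, I (y + Q b) * I (y + Q b') := by
        rw [sum_comm]
        refine sum_congr rfl fun b _ => ?_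
        rw [sum_comm]
    _ = ∑ b, ∑ b', ∑ w, I w * I (w + (Q b' - Q b)) := by
        refine sum_congr rfl fun b _ => sum_congr rfl fun b' _ => ?_
        rw [← sum_shift (fun w => I w * I (w + (Q b' - Q b))) (Q b)]
        refine sum_congr rfl fun y _ => ?_
        congr 2
        ring
    _ = ∑ w, ∑ b, ∑ b', I w * I (w + (Q b' - Q b)) := by
        symm
        rw [sum_comm]
        refine sum_congr rfl fun b _ => ?_
        rw [sum_comm]
    _ = ∑ w, I w * ∑ b, ∑ b', I (w + (Q b' - Q b)) := by
        refine sum_congr rfl fun w _ => ?_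
        rw [mul_sum]
        refine sum_congr rfl fun b _ => ?_
        rw [mul_sum]
    _ ≤ ∑ w, I w * (Fintype.card F * s + Fintype.card F) :=
        sum_le_sum fun w _ => mul_le_mul_of_nonneg_left (inner w) (hI0 w)
    _ = _ := by rw [← sum_mul]

lemma G_le (S : Finset F) (h2 : (2 : F) ≠ 0) (h3 : (3 : F) ≠ 0) (a a' : F) (hne : a ≠ a')
    (I : F → ℝ) (hI : I = fun x => if x ∈ S then 1 else 0) :
    ∑ b, ∑ z, I ((a - b) ^ 3 + z) * I ((a' - b) ^ 3 + z)
      ≤ (S.card : ℝ) ^ 2 + S.card * √(Fintype.card F) := by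
  have hs : ∑ x, I x = S.card := by simp [hI]
  have hI0 : ∀ x, 0 ≤ I x := by intro x; rw [hI]; dsimp only; split_ifs <;> norm_num
  have hI1 : ∀ x, I x ≤ 1 := by intro x; rw [hI]; dsimp only; split_ifs <;> norm_num
  set h : F → ℝ := fun y => ∑ b, I (y + ((a - b) ^ 3 - (a' - b) ^ 3)) with hh
  have hsq := sum_sq_h I hI0 hI1 h2 h3 a a' hne
  rw [hs] at hsq
  set s : ℝ := (S.card : ℝ) with hsd
  set P : ℝ := (Fintype.card F : ℝ) with hP
  have hsum : ∑ y, h y = P * s := by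
    simp only [hh]
    rw [sum_comm]
    simp_rw [sum_shift, hs]
    simp [card_univ, hP]
  have hvar : ∑ y, (h y - s) ^ 2 ≤ s * P := by
    have : ∑ y, (h y - s) ^ 2 = ∑ y, h y ^ 2 - 2 * s * ∑ y, h y + P * s ^ 2 := by
      rw [mul_sum, ← sum_sub_distrib]
      have : P * s ^ 2 = ∑ y : F, s ^ 2 := by simp [card_univ, hP]
      rw [this, ← sum_add_distrib]
      refine sum_congr rfl fun y _ => ?_
      ring
    rw [this, hsum]
    have : ∑ y, h y ^ 2 ≤ s * (P * s + P) := hsq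
    nlinarith
  have hG : ∑ b, ∑ z, I ((a - b) ^ 3 + z) * I ((a' - b) ^ 3 + z) = ∑ y ∈ S, h y := by
    calc _ = ∑ b, ∑ y, I y * I (y + ((a - b) ^ 3 - (a' - b) ^ 3)) := by
          refine sum_congr rfl fun b _ => ?_
          rw [← sum_shift (fun y => I y * I (y + ((a - b) ^ 3 - (a' - b) ^ 3))) ((a' - b) ^ 3)]
          refine sum_congr rfl fun z _ => ?_
          rw [mul_comm]
          congr 2 <;> ring
      _ = ∑ y, I y * h y := by
          rw [sum_comm]
          simp_rw [hh, mul_sum]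
      _ = _ := by simp [hI]
  rw [hG]
  have h1 : ∑ y ∈ S, h y = s ^ 2 + ∑ y ∈ S, (h y - s) := by
    rw [sum_sub_distrib]; simp [hsd]; ring
  have h4 : (∑ y ∈ S, (h y - s)) ^ 2 ≤ s * (s * P) := by
    calc _ ≤ s * ∑ y ∈ S, (h y - s) ^ 2 := sq_sum_le_card_mul_sum_sq
      _ ≤ s * ∑ y, (h y - s) ^ 2 := by
          gcongr
          exact subset_univ S
      _ ≤ _ := by gcongr
  have h5 : ∑ y ∈ S, (h y - s) ≤ s * √P := by
    refine le_of_abs_le (abs_le_of_sq_le_sq ?_ (by positivity))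
    rw [mul_pow, Real.sq_sqrt (Nat.cast_nonneg _)]
    linarith
  linarith

lemma charsum (A : Finset F) (h2 : (2 : F) ≠ 0) (h3 : (3 : F) ≠ 0) (hA : A.Nonempty)
    (hp : Fintype.card F ≤ A.card ^ 2)
    (hS : 2 * (cubes A + cubes A).card ≤ Fintype.card F) :
    (A.card : ℝ) * (A - A).card ≤ 24 * ((cubes A + cubes A).card * √(Fintype.card F)) := by
  set S := cubes A + cubes A with hSd
  set I : F → ℝ := fun x => if x ∈ S then 1 else 0 with hI
  have hs : ∑ x, I x = S.card := by simp [hI]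
  have hII : ∀ x, I x * I x = I x := by intro x; simp [hI]
  have hD : ((A - A).card : ℝ) ≤ 3 * (cubes A).card := by exact_mod_cast cubes_card A
  set n : ℝ := (A.card : ℝ) with hn
  set s : ℝ := (S.card : ℝ) with hsd
  set P : ℝ := (Fintype.card F : ℝ) with hP
  have hP0 : 0 < P := by rw [hP]; exact_mod_cast Fintype.card_pos
  have hn0 : 0 < n := by rw [hn]; exact_mod_cast hA.card_pos
  have hs0 : 0 ≤ s := Nat.cast_nonneg _
  have hsP : 2 * s ≤ P := by rw [hsd, hP]; exact_mod_cast hS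
  have hPn : √P ≤ n := by
    rw [Real.sqrt_le_left hn0.le, hP, hn]; exact_mod_cast hp
  set f : F → F → ℝ := fun b z => ∑ a ∈ A, I ((a - b) ^ 3 + z) with hf
  have hfsum : ∑ b, ∑ z, f b z = n * P * s := by
    have : ∀ b, ∑ z, f b z = n * s := by
      intro b
      simp only [hf]
      rw [sum_comm]
      have : ∀ a ∈ A, ∑ z, I ((a - b) ^ 3 + z) = s := by
        intro a _
        simp_rw [add_comm ((a - b) ^ 3)]
        rw [sum_shift, hs]
      rw [sum_congr rfl this]
      simp [hn]
    simp_rw [this]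
    simp [card_univ, hP]; ring
  have hfsq : ∑ b, ∑ z, f b z ^ 2 ≤ n * (P * s) + n ^ 2 * (s ^ 2 + s * √P) := by
    have e : ∑ b, ∑ z, f b z ^ 2
        = ∑ a ∈ A, ∑ a' ∈ A, ∑ b, ∑ z, I ((a - b) ^ 3 + z) * I ((a' - b) ^ 3 + z) := by
      have : ∀ b z, f b z ^ 2 = ∑ a ∈ A, ∑ a' ∈ A, I ((a - b) ^ 3 + z) * I ((a' - b) ^ 3 + z) := by
        intro b z
        rw [sq]; simp only [hf]; rw [sum_mul_sum]
      simp_rw [this]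
      rw [← sum_product', sum_comm]
      refine sum_congr rfl fun a _ => ?_
      rw [sum_comm]
      refine sum_congr rfl fun a' _ => ?_
      rw [← sum_product']
    rw [e]
    calc _ ≤ ∑ a ∈ A, ∑ a' ∈ A, ((if a = a' then P * s else 0) + (s ^ 2 + s * √P)) := by
          refine sum_le_sum fun a _ => sum_le_sum fun a' _ => ?_
          by_cases h : a = a'
          · subst h
            rw [if_pos rfl]
            simp_rw [hII]
            have : ∀ b, ∑ z, I ((a - b) ^ 3 + z) = s := by
              intro b
              simp_rw [add_comm ((a - b) ^ 3)]
              rw [sum_shift, hs]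
            simp_rw [this]
            have h0 : 0 ≤ s ^ 2 + s * √P := by positivity
            simp [card_univ]
            linarith
          · rw [if_neg h, zero_add]
            exact G_le S h2 h3 a a' h I hI
      _ = _ := by
          simp_rw [sum_add_distrib]
          simp [hn]
          ring
  have hvar : ∑ b, ∑ z, (f b z - n * s / P) ^ 2 ≤ n * (P * s) + n ^ 2 * (s * √P) := by
    have e : ∑ b, ∑ z, (f b z - n * s / P) ^ 2
        = ∑ b, ∑ z, f b z ^ 2 - 2 * (n * s / P) * ∑ b, ∑ z, f b z
          + P * (P * (n * s / P) ^ 2) := by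
      have e1 : P * (P * (n * s / P) ^ 2) = ∑ _b : F, ∑ _z : F, (n * s / P) ^ 2 := by
        simp [card_univ, hP]
      rw [e1]
      simp_rw [mul_sum]
      rw [← sum_sub_distrib, ← sum_add_distrib]
      refine sum_congr rfl fun b _ => ?_
      rw [← sum_sub_distrib, ← sum_add_distrib]
      refine sum_congr rfl fun z _ => ?_
      ring
    rw [e, hfsum]
    have e2 : 2 * (n * s / P) * (n * P * s) = 2 * (n ^ 2 * s ^ 2) := by field_simp
    have e3 : P * (P * (n * s / P) ^ 2) = n ^ 2 * s ^ 2 := by field_simp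
    rw [e2, e3]
    linarith
  have hlow : n * (cubes A).card * (n / 2) ^ 2 ≤ ∑ b, ∑ z, (f b z - n * s / P) ^ 2 := by
    calc n * (cubes A).card * (n / 2) ^ 2 = ∑ b ∈ A, ∑ z ∈ cubes A, (n / 2) ^ 2 := by
          simp [hn]; ring
      _ ≤ ∑ b ∈ A, ∑ z ∈ cubes A, (f b z - n * s / P) ^ 2 := by
          refine sum_le_sum fun b hb => sum_le_sum fun z hz => ?_
          have : f b z = n := by
            simp only [hf]
            rw [sum_congr rfl (g := fun _ => (1 : ℝ))]
            · simp [hn]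
            · intro a ha
              simp only [hI]
              rw [if_pos]
              exact add_mem_add (cube_mem ha hb) hz
          rw [this]
          have h1 : n * s / P ≤ n / 2 := by
            rw [div_le_iff₀ hP0]
            nlinarith
          refine pow_le_pow_left₀ (by positivity) ?_ 2
          linarith
      _ ≤ ∑ b ∈ A, ∑ z, (f b z - n * s / P) ^ 2 :=
          sum_le_sum fun b _ => sum_le_sum_of_subset_of_nonneg (subset_univ _)
            fun _ _ _ => sq_nonneg _
      _ ≤ _ := sum_le_sum_of_subset_of_nonneg (subset_univ _)
            fun _ _ _ => sum_nonneg fun _ _ => sq_nonneg _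
  have hPs : n * (P * s) ≤ n ^ 2 * (s * √P) := by
    calc n * (P * s) = n * (√P * √P * s) := by rw [Real.mul_self_sqrt hP0.le]
      _ = n * s * √P * √P := by ring
      _ ≤ n * s * √P * n := by gcongr
      _ = _ := by ring
  have fin : n ^ 2 * (n * (cubes A).card) ≤ n ^ 2 * (8 * (s * √P)) := by nlinarith
  have fin2 := le_of_mul_le_mul_left fin (by positivity)
  calc n * ((A - A).card : ℝ) ≤ n * (3 * (cubes A).card) := by gcongr
    _ = 3 * (n * (cubes A).card) := by ring
    _ ≤ 3 * (8 * (s * √P)) := by gcongr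
    _ = _ := by ring

end CharSum
end CubeExp

namespace CubeExp
section RegimeIII
open scoped Pointwise
variable {F : Type*} [Field F] [DecidableEq F] [Fintype F]

lemma energy_lower (A : Finset F) (ξ : F) :
    A.card ^ 4 ≤ Fintype.card F * (((A ×ˢ A) ×ˢ (A ×ˢ A)).filter
      (fun q => q.1.1 - q.1.2 = ξ * (q.2.1 - q.2.2))).card := by
  have h := cs_card (A ×ˢ A) (fun q => q.1 - ξ * q.2) (univ : Finset F) (fun _ _ => mem_univ _)
  rw [card_product, card_univ] at h
  calc A.card ^ 4 = (A.card * A.card) ^ 2 := by ring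
    _ ≤ _ := h
    _ ≤ _ := by
      refine Nat.mul_le_mul_left _ ?_
      refine card_le_card_of_injOn (fun q => ((q.1.1, q.2.1), (q.1.2, q.2.2))) ?_ ?_
      · rintro ⟨⟨x, w⟩, ⟨x', w'⟩⟩ h
        simp only [coe_filter, mem_product, Set.mem_ofPred_eq] at h ⊢
        obtain ⟨⟨⟨h1, h2⟩, h3, h4⟩, h⟩ := h
        exact ⟨⟨⟨h1, h3⟩, h2, h4⟩, by linear_combination h⟩
      · rintro ⟨⟨x, w⟩, ⟨x', w'⟩⟩ _ ⟨⟨u, v⟩, ⟨u', v'⟩⟩ _ h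
        simp only [Prod.mk.injEq] at h ⊢
        tauto

/-- pairs with unpopular difference are few -/
lemma unpopular (A : Finset F) (hA : A.Nonempty) :
    (((A ×ˢ A).filter (fun q => ¬ ((A.card : ℝ) ^ 2 / (16 * (A - A).card)
      ≤ (sh A (q.1 - q.2)).card))).card : ℝ) ≤ (A.card : ℝ) ^ 2 / 16 := by
  have hD0 : (0 : ℝ) < (A - A).card := by exact_mod_cast (hA.sub hA).card_pos
  set u : ℝ := (A.card : ℝ) ^ 2 / (16 * (A - A).card) with hu
  have hu0 : 0 ≤ u := by positivity
  rw [card_eq_sum_card_fiberwise (t := A - A) (f := fun q => q.1 - q.2)]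
  · push_cast
    calc _ ≤ ∑ t ∈ A - A, u := by
          refine sum_le_sum fun t _ => ?_
          by_cases ht : u ≤ (sh A t).card
          · rw [filter_eq_empty_iff.2]
            · simpa using hu0
            · intro q hq h
              rw [mem_filter] at hq
              rw [h] at hq
              exact hq.2 ht
          · refine le_trans ?_ (not_le.1 ht).le
            have : (((A ×ˢ A).filter (fun q => ¬ (u ≤ (sh A (q.1 - q.2)).card))).filter
              (fun q => q.1 - q.2 = t)).card ≤ (sh A t).card := by
              refine card_le_card_of_injOn (fun q => q.1) ?_ ?_
              · rintro ⟨x, y⟩ h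
                simp only [coe_filter, mem_filter, mem_product, Set.mem_ofPred_eq] at h
                simp only [sh, coe_filter, Set.mem_ofPred_eq]
                refine ⟨h.1.1.1, ?_⟩
                rw [← h.2]
                simpa using h.1.1.2
              · rintro ⟨x, y⟩ h ⟨x', y'⟩ h' e
                simp only [coe_filter, mem_filter, mem_product, Set.mem_ofPred_eq] at h h' e
                have e2 := h.2.trans h'.2.symm
                rw [e] at e2
                exact Prod.ext e (sub_right_injective e2)
            exact_mod_cast this
      _ = (A.card : ℝ) ^ 2 / 16 := by
          rw [sum_const, nsmul_eq_mul, hu]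
          field_simp
  · intro q hq
    simp only [coe_filter, mem_product, Set.mem_ofPred_eq] at hq
    exact sub_mem_sub hq.1.1 hq.1.2

lemma good_dirs (A : Finset F) (hA : A.Nonempty) (hp4 : 4 ≤ Fintype.card F)
    (hp : 2 * Fintype.card F ≤ A.card ^ 2) :
    ∃ Ξ : Finset F, (Fintype.card F : ℝ) / 2 ≤ Ξ.card ∧
      ∀ ξ ∈ Ξ, ∃ a ∈ A, ∃ a' ∈ A, ∃ b ∈ A, ∃ b' ∈ A, a - a' = ξ * (b - b') ∧ b ≠ b' ∧
        (A.card : ℝ) ^ 2 / (16 * (A - A).card) ≤ (sh A (a - a')).card ∧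
        (A.card : ℝ) ^ 2 / (16 * (A - A).card) ≤ (sh A (b - b')).card := by
  classical
  set u : ℝ := (A.card : ℝ) ^ 2 / (16 * (A - A).card) with hu
  set Ξ : Finset F := univ.filter (fun ξ => ∃ a ∈ A, ∃ a' ∈ A, ∃ b ∈ A, ∃ b' ∈ A,
    a - a' = ξ * (b - b') ∧ b ≠ b' ∧ u ≤ (sh A (a - a')).card ∧ u ≤ (sh A (b - b')).card) with hΞ
  refine ⟨Ξ, ?_, fun ξ hξ => (mem_filter.1 hξ).2⟩
  set Z := (A ×ˢ A).filter (fun q => ¬ (u ≤ (sh A (q.1 - q.2)).card)) with hZ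
  have hZc : (Z.card : ℝ) ≤ (A.card : ℝ) ^ 2 / 16 := unpopular A hA
  set T := Z ×ˢ (A ×ˢ A) ∪ (A ×ˢ A) ×ˢ Z with hT
  have hTc : (T.card : ℝ) ≤ (A.card : ℝ) ^ 4 / 8 := by
    have h1 : T.card ≤ 2 * (Z.card * A.card ^ 2) := by
      refine (card_union_le _ _).trans ?_
      rw [card_product, card_product (A ×ˢ A) Z, card_product A A]
      apply le_of_eq; ring
    have h1' : (T.card : ℝ) ≤ 2 * (Z.card * (A.card : ℝ) ^ 2) := by exact_mod_cast h1
    have : (Z.card : ℝ) * (A.card : ℝ) ^ 2 ≤ (A.card : ℝ) ^ 2 / 16 * (A.card : ℝ) ^ 2 := by gcongr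
    nlinarith
  set bad := univ \ Ξ with hbad
  -- each bad direction has many pairs in `T`
  have hb : ∀ ξ ∈ bad, (A.card : ℝ) ^ 4 / (2 * Fintype.card F) ≤
      (T.filter (fun q => q.2.1 ≠ q.2.2 ∧ q.1.1 - q.1.2 = ξ * (q.2.1 - q.2.2))).card := by
    intro ξ hξ
    have h1 := energy_lower A ξ
    have h2 : (((A ×ˢ A) ×ˢ (A ×ˢ A)).filter
      (fun q => q.1.1 - q.1.2 = ξ * (q.2.1 - q.2.2))).card ≤ A.card ^ 2 +
      (T.filter (fun q => q.2.1 ≠ q.2.2 ∧ q.1.1 - q.1.2 = ξ * (q.2.1 - q.2.2))).card := by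
      have hsub : ((A ×ˢ A) ×ˢ (A ×ˢ A)).filter (fun q => q.1.1 - q.1.2 = ξ * (q.2.1 - q.2.2)) ⊆
        (A ×ˢ A).image (fun x => ((x.1, x.1), (x.2, x.2))) ∪
        (T.filter (fun q => q.2.1 ≠ q.2.2 ∧ q.1.1 - q.1.2 = ξ * (q.2.1 - q.2.2))) := by
        rintro ⟨⟨a, a'⟩, ⟨b, b'⟩⟩ hq
        simp only [mem_filter, mem_product] at hq
        obtain ⟨⟨⟨ha, ha'⟩, hb, hb'⟩, e⟩ := hq
        rw [mem_union]
        by_cases hne : b = b'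
        · left
          subst hne
          rw [sub_self, mul_zero, sub_eq_zero] at e
          subst e
          exact mem_image.2 ⟨(a, b), mem_product.2 ⟨ha, hb⟩, rfl⟩
        · right
          rw [mem_filter]
          refine ⟨?_, hne, e⟩
          by_contra hc
          simp only [hT, hZ, mem_union, mem_product, mem_filter, ha, ha', hb, hb', true_and,
            and_true, not_or, not_not] at hc
          have : ξ ∈ Ξ := by
            rw [hΞ, mem_filter]
            exact ⟨mem_univ _, a, ha, a', ha', b, hb, b', hb', e, hne, hc.1, hc.2⟩
          exact (mem_sdiff.1 hξ).2 this
      refine (card_le_card hsub).trans ((card_union_le _ _).trans ?_)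
      refine Nat.add_le_add_right ?_ _
      refine card_image_le.trans ?_
      rw [card_product, sq]
    set R := (((A ×ˢ A) ×ˢ (A ×ˢ A)).filter
      (fun q => q.1.1 - q.1.2 = ξ * (q.2.1 - q.2.2))).card
    set R' := (T.filter (fun q => q.2.1 ≠ q.2.2 ∧ q.1.1 - q.1.2 = ξ * (q.2.1 - q.2.2))).card
    have h1r : (A.card : ℝ) ^ 4 ≤ Fintype.card F * R := by exact_mod_cast h1
    have h2r : (R : ℝ) ≤ (A.card : ℝ) ^ 2 + R' := by exact_mod_cast h2
    have hpr : 2 * (Fintype.card F : ℝ) ≤ (A.card : ℝ) ^ 2 := by exact_mod_cast hp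
    have hP0 : (0 : ℝ) < Fintype.card F := by exact_mod_cast Fintype.card_pos
    rw [div_le_iff₀ (by positivity)]
    set P : ℝ := (Fintype.card F : ℝ)
    set n : ℝ := (A.card : ℝ)
    have h5 : P * R ≤ P * (n ^ 2 + R') := by gcongr
    have h6 : 2 * P * n ^ 2 ≤ n ^ 2 * n ^ 2 := by gcongr
    nlinarith
  have hsum : ∑ ξ ∈ bad,
      (T.filter (fun q => q.2.1 ≠ q.2.2 ∧ q.1.1 - q.1.2 = ξ * (q.2.1 - q.2.2))).card ≤ T.card := by
    simp_rw [card_filter]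
    rw [sum_comm, card_eq_sum_ones]
    refine sum_le_sum fun q _ => ?_
    rw [← card_filter, card_le_one]
    intro x hx y hy
    simp only [mem_filter] at hx hy
    exact mul_right_cancel₀ (sub_ne_zero.2 hx.2.1) (hx.2.2.symm.trans hy.2.2)
  have hsumr : (∑ ξ ∈ bad,
      ((T.filter (fun q => q.2.1 ≠ q.2.2 ∧ q.1.1 - q.1.2 = ξ * (q.2.1 - q.2.2))).card : ℝ))
      ≤ T.card := by exact_mod_cast hsum
  have h8 := (sum_le_sum hb).trans (hsumr.trans hTc)
  rw [sum_const, nsmul_eq_mul] at h8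
  have hP0 : (0 : ℝ) < Fintype.card F := by exact_mod_cast Fintype.card_pos
  have hn0 : (0 : ℝ) < A.card := by exact_mod_cast hA.card_pos
  have hbc : (bad.card : ℝ) ≤ Fintype.card F / 4 := by
    refine le_of_mul_le_mul_right (a := (A.card : ℝ) ^ 4 / (2 * Fintype.card F)) ?_ (by positivity)
    refine h8.trans (le_of_eq ?_)
    field_simp; norm_num
  have htot : bad.card + Ξ.card = Fintype.card F := by
    rw [hbad, card_sdiff_add_card_eq_card (subset_univ _), card_univ]
  have htotr : (bad.card : ℝ) + Ξ.card = Fintype.card F := by exact_mod_cast htot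
  linarith

lemma quadP (A : Finset F) (h2 : (2 : F) ≠ 0) (h3 : (3 : F) ≠ 0) (hA : A.Nonempty)
    (hp4 : 4 ≤ Fintype.card F) (hp : 2 * Fintype.card F ≤ A.card ^ 2) :
    (Fintype.card F : ℝ) * (A.card : ℝ) ^ 6 ≤
      41472 * ((cubes A + cubes A).card : ℝ) ^ 4 * ((A - A).card : ℝ) ^ 3 := by
  classical
  obtain ⟨Ξ, hΞc, hrep⟩ := good_dirs A hA hp4 hp
  obtain ⟨M, hM, hMc⟩ := exists_M2 A
  have hXP : (Ξ.card : ℝ) ≤ Fintype.card F := by exact_mod_cast card_le_univ Ξ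
  have hpr : 2 * (Fintype.card F : ℝ) ≤ (A.card : ℝ) ^ 2 := by exact_mod_cast hp
  choose! a ha a' ha' b hb b' hb' e hne hpa hpb using hrep
  have hinj : ∀ s : F, Function.Injective (fun x => 2 * x - s) := by
    intro s x y h
    exact mul_left_cancel₀ h2 (sub_left_injective h)
  have hP0 : (0 : ℝ) < Fintype.card F := by exact_mod_cast Fintype.card_pos
  have hn0 : (0 : ℝ) < A.card := by exact_mod_cast hA.card_pos
  have hD0 : (0 : ℝ) < (A - A).card := by exact_mod_cast (hA.sub hA).card_pos
  have h := quad_general A h2 h3 hA Ξ M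
    (fun ξ => (sh A (a ξ - a' ξ)).image (fun x => 2 * x - (a ξ - a' ξ)))
    (fun ξ => (sh A (b ξ - b' ξ)).image (fun x => 2 * x - (b ξ - b' ξ)))
    ((A.card : ℝ) ^ 2 / (16 * (A - A).card)) A.card
    (by positivity) (by positivity)
    (by
      intro ξ hξ
      refine ⟨?_, ?_⟩
      · intro x hx
        obtain ⟨y, hy, rfl⟩ := mem_image.1 hx
        simp only [sh, mem_filter] at hy
        rw [show 2 * y - (a ξ - a' ξ) = y + (y - (a ξ - a' ξ)) by ring]
        exact hM _ hy.1 _ hy.2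
      · rw [card_image_of_injective _ (hinj _)]; exact hpa ξ hξ)
    (by
      intro ξ hξ
      refine ⟨?_, ?_⟩
      · intro x hx
        obtain ⟨y, hy, rfl⟩ := mem_image.1 hx
        simp only [sh, mem_filter] at hy
        rw [show 2 * y - (b ξ - b' ξ) = y + (y - (b ξ - b' ξ)) by ring]
        exact hM _ hy.1 _ hy.2
      · rw [card_image_of_injective _ (hinj _)]; exact hpb ξ hξ)
    (by
      intro ξ hξ σ hσ τ hτ
      obtain ⟨y, hy, rfl⟩ := mem_image.1 hσ
      obtain ⟨z, hz, rfl⟩ := mem_image.1 hτ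
      simp only [sh, mem_filter] at hy hz
      have h0 : sh A 0 = A := by simp [sh]
      refine ⟨y, hy.1, y - (a ξ - a' ξ), hy.2, z, hz.1, z - (b ξ - b' ξ), hz.2, 0, 0, ?_, ?_, ?_, ?_,
        ?_, ?_⟩
      · linear_combination e ξ hξ
      · intro h
        apply hne ξ hξ
        linear_combination h
      · ring
      · ring
      · rw [h0]
      · rw [h0])
  set P : ℝ := (Fintype.card F : ℝ) with hPd
  set n : ℝ := (A.card : ℝ) with hn
  set D : ℝ := ((A - A).card : ℝ) with hD
  set S : ℝ := ((cubes A + cubes A).card : ℝ) with hS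
  set X : ℝ := (Ξ.card : ℝ) with hX
  set m : ℝ := (M.card : ℝ) with hm
  have k0 : n ^ 4 + 4 * n ^ 2 * X ≤ 3 * n ^ 4 := by
    have : n ^ 2 * (2 * X) ≤ n ^ 2 * n ^ 2 := by gcongr; linarith
    nlinarith
  have k1 : P / 2 * (n ^ 2 / (16 * D)) ^ 2 * n ^ 4 * D ^ 3 ≤ 27 * S ^ 4 * (m ^ 2 * (3 * n ^ 4)) := by
    calc _ ≤ X * (n ^ 2 / (16 * D)) ^ 2 * n ^ 4 * D ^ 3 := by gcongr
      _ ≤ _ := h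
      _ ≤ _ := by gcongr
  have k2 : P * n ^ 4 * D ≤ 41472 * S ^ 4 * m ^ 2 := by
    refine le_of_mul_le_mul_right (a := n ^ 4 / 512) ?_ (by positivity)
    calc _ = P / 2 * (n ^ 2 / (16 * D)) ^ 2 * n ^ 4 * D ^ 3 := by field_simp; norm_num
      _ ≤ _ := k1
      _ = _ := by ring
  refine le_of_mul_le_mul_right (a := D) ?_ hD0
  calc P * n ^ 6 * D = P * n ^ 4 * D * n ^ 2 := by ring
    _ ≤ 41472 * S ^ 4 * m ^ 2 * n ^ 2 := by gcongr
    _ = 41472 * S ^ 4 * (m * n) ^ 2 := by ring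
    _ ≤ 41472 * S ^ 4 * (D ^ 2) ^ 2 := by gcongr
    _ = _ := by ring

lemma regimeIII (A : Finset F) (h2 : (2 : F) ≠ 0) (h3 : (3 : F) ≠ 0) (hA : A.Nonempty)
    (hp4 : 4 ≤ Fintype.card F) (hp : 2 * Fintype.card F ≤ A.card ^ 2)
    (hS : 2 * (cubes A + cubes A).card ≤ Fintype.card F) :
    (A.card : ℝ) ^ 8 ≤ 24 ^ 3 * 41472 * ((cubes A + cubes A).card : ℝ) ^ 7 := by
  have h1 := quadP A h2 h3 hA hp4 hp
  have h5 := charsum A h2 h3 hA (by omega) hS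
  have hP0 : (0 : ℝ) < Fintype.card F := by exact_mod_cast Fintype.card_pos
  have hn0 : (0 : ℝ) < A.card := by exact_mod_cast hA.card_pos
  have hPn : √(Fintype.card F : ℝ) ≤ A.card := by
    rw [Real.sqrt_le_left hn0.le]
    have : Fintype.card F ≤ A.card ^ 2 := by omega
    exact_mod_cast this
  have hw : (Fintype.card F : ℝ) = √(Fintype.card F : ℝ) ^ 2 := (Real.sq_sqrt hP0.le).symm
  have hw0 : 0 < √(Fintype.card F : ℝ) := Real.sqrt_pos.2 hP0
  rw [hw] at h1
  clear hw
  set w : ℝ := √(Fintype.card F : ℝ)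
  set n : ℝ := (A.card : ℝ) with hn
  set D : ℝ := ((A - A).card : ℝ) with hD
  set S : ℝ := ((cubes A + cubes A).card : ℝ) with hSd
  have hD0 : 0 ≤ D := Nat.cast_nonneg _
  have hS0 : 0 ≤ S := Nat.cast_nonneg _
  refine le_of_mul_le_mul_right (a := w ^ 3) ?_ (by positivity)
  calc n ^ 8 * w ^ 3 = w ^ 2 * n ^ 6 * (n ^ 2 * w) := by ring
    _ ≤ w ^ 2 * n ^ 6 * (n ^ 2 * n) := by gcongr
    _ = w ^ 2 * n ^ 6 * n ^ 3 := by ring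
    _ ≤ 41472 * S ^ 4 * D ^ 3 * n ^ 3 := by gcongr
    _ = 41472 * S ^ 4 * (n * D) ^ 3 := by ring
    _ ≤ 41472 * S ^ 4 * (24 * (S * w)) ^ 3 := by gcongr
    _ = _ := by ring

end RegimeIII
end CubeExp

namespace CubeExp
section Final
open scoped Pointwise

lemma image_eq {p : ℕ} (A : Finset (ZMod p)) [Fact p.Prime] :
    ((A ×ˢ A) ×ˢ (A ×ˢ A)).image
      (fun q => (q.1.1 - q.1.2) ^ 3 + (q.2.1 - q.2.2) ^ 3) = cubes A + cubes A := by
  ext x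
  simp only [mem_image, mem_product, mem_add, cubes, mem_sub, Prod.exists]
  constructor
  · rintro ⟨a, b, c, d, ⟨⟨ha, hb⟩, hc, hd⟩, rfl⟩
    exact ⟨_, ⟨_, ⟨a, ha, b, hb, rfl⟩, rfl⟩, _, ⟨_, ⟨c, hc, d, hd, rfl⟩, rfl⟩, rfl⟩
  · rintro ⟨_, ⟨_, ⟨a, ha, b, hb, rfl⟩, rfl⟩, _, ⟨_, ⟨c, hc, d, hd, rfl⟩, rfl⟩, rfl⟩
    exact ⟨((a, b), (c, d)).1.1, _, _, _, ⟨⟨ha, hb⟩, hc, hd⟩, rfl⟩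

lemma regimeI' {p : ℕ} [Fact p.Prime] (hp3 : 3 < p) (A : Finset (ZMod p)) (h4 : 4 ≤ A.card)
    (hp : A.card ^ 2 ≤ p) :
    (A.card : ℝ) ^ 8 ≤ ((4 * 3 ^ 8) ^ 13 * 10368 ^ 5) * ((cubes A + cubes A).card : ℝ) ^ 7 := by
  have h := regimeI hp3 A h4 hp
  have hn : (1 : ℝ) ≤ A.card := by exact_mod_cast (by omega : 1 ≤ A.card)
  have hC : (1 : ℝ) ≤ (4 * 3 ^ 8) ^ 13 * 10368 ^ 5 := by norm_num
  set C : ℝ := (4 * 3 ^ 8) ^ 13 * 10368 ^ 5 with hCd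
  clear_value C
  set n : ℝ := (A.card : ℝ)
  set S : ℝ := ((cubes A + cubes A).card : ℝ) with hSd
  have hS0 : 0 ≤ S := Nat.cast_nonneg _
  refine le_of_pow_le_pow_left₀ (n := 124) (by norm_num) (by positivity) ?_
  calc (n ^ 8) ^ 124 = n ^ 992 := by rw [← pow_mul]
    _ ≤ n ^ 994 := pow_le_pow_right₀ hn (by norm_num)
    _ = (n ^ 142) ^ 7 := by rw [← pow_mul]
    _ ≤ (C * S ^ 124) ^ 7 := by gcongr
    _ = C ^ 7 * (S ^ 7) ^ 124 := by rw [mul_pow, ← pow_mul, ← pow_mul]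
    _ ≤ C ^ 124 * (S ^ 7) ^ 124 := by
      gcongr
      · norm_num
    _ = _ := by rw [mul_pow]

lemma main_bound {p : ℕ} [Fact p.Prime] (A : Finset (ZMod p))
    (h : (A.card : ℝ) ^ 12 ≤ (p : ℝ) ^ 7) :
    (A.card : ℝ) ^ 8 ≤ (4 ^ 8 * ((4 * 3 ^ 8) ^ 13 * 10368 ^ 5))
      * ((cubes A + cubes A).card : ℝ) ^ 7 := by
  rcases A.eq_empty_or_nonempty with rfl | hA
  · rw [card_empty, Nat.cast_zero, zero_pow (by norm_num)]
    positivity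
  have hS1 : (1 : ℝ) ≤ ((cubes A + cubes A).card : ℝ) := by
    obtain ⟨a, ha⟩ := hA
    exact_mod_cast card_pos.2 ⟨_, add_mem_add (cube_mem ha ha) (cube_mem ha ha)⟩
  have hS7 : (1 : ℝ) ≤ ((cubes A + cubes A).card : ℝ) ^ 7 := one_le_pow₀ hS1
  have hn1 : (1 : ℝ) ≤ A.card := by exact_mod_cast hA.card_pos
  by_cases hsmall : A.card ≤ 5
  · have h5 : (A.card : ℝ) ≤ 5 := by exact_mod_cast hsmall
    calc (A.card : ℝ) ^ 8 ≤ 5 ^ 8 := by gcongr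
      _ ≤ (4 ^ 8 * ((4 * 3 ^ 8) ^ 13 * 10368 ^ 5)) * 1 := by norm_num
      _ ≤ _ := by gcongr
  have hcardp : A.card ≤ p := by
    have := card_le_univ A
    rwa [ZMod.card] at this
  have hp3 : 3 < p := by omega
  have ne : ∀ k : ℕ, 0 < k → k < p → ((k : ℕ) : ZMod p) ≠ 0 := by
    intro k hk hkp h
    rw [ZMod.natCast_eq_zero_iff] at h
    exact absurd (Nat.le_of_dvd hk h) (by omega)
  have h2 : (2 : ZMod p) ≠ 0 := by exact_mod_cast ne 2 (by norm_num) (by omega)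
  have h3 : (3 : ZMod p) ≠ 0 := by exact_mod_cast ne 3 (by norm_num) (by omega)
  by_cases hI : A.card ^ 2 ≤ p
  · refine (regimeI' hp3 A (by omega) hI).trans ?_
    refine mul_le_mul_of_nonneg_right ?_ (by positivity)
    norm_num
  by_cases hIII : 2 * p ≤ A.card ^ 2
  · by_cases hS : 2 * (cubes A + cubes A).card ≤ p
    · refine (regimeIII A h2 h3 hA (by rw [ZMod.card]; omega) (by rw [ZMod.card]; omega)
        (by rw [ZMod.card]; omega)).trans ?_
      refine mul_le_mul_of_nonneg_right ?_ (by positivity)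
      norm_num
    · have hS' : (p : ℝ) ≤ 2 * (cubes A + cubes A).card := by
        exact_mod_cast (not_le.1 hS).le
      calc (A.card : ℝ) ^ 8 ≤ (A.card : ℝ) ^ 12 := pow_le_pow_right₀ hn1 (by norm_num)
        _ ≤ (p : ℝ) ^ 7 := h
        _ ≤ (2 * (cubes A + cubes A).card) ^ 7 := by gcongr
        _ = 2 ^ 7 * ((cubes A + cubes A).card : ℝ) ^ 7 := by rw [mul_pow]
        _ ≤ _ := by
          refine mul_le_mul_of_nonneg_right ?_ (by positivity)
          norm_num
  · push Not at hI hIII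
    have hm1 := Nat.sqrt_le' p
    have hm2 := Nat.lt_succ_sqrt' p
    have hmn : Nat.sqrt p ≤ A.card := by
      by_contra hc
      have : A.card ^ 2 ≤ (Nat.sqrt p) ^ 2 := Nat.pow_le_pow_left (by omega) 2
      omega
    obtain ⟨A1, hA1, hc1⟩ := exists_subset_card_eq hmn
    set m := Nat.sqrt p with hm
    rw [Nat.succ_eq_add_one] at hm2
    have hm4 : 4 ≤ m := by
      by_contra hc
      have h16 : (m + 1) ^ 2 ≤ 4 ^ 2 := Nat.pow_le_pow_left (by omega) 2
      have h36 : 6 ^ 2 ≤ A.card ^ 2 := Nat.pow_le_pow_left (by omega) 2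
      omega
    have hn4 : A.card ≤ 4 * m := by
      by_contra hc
      have hx : (4 * m) ^ 2 ≤ A.card ^ 2 := Nat.pow_le_pow_left (by omega) 2
      nlinarith
    have hr := regimeI' hp3 A1 (by omega) (by rw [hc1]; exact hm1)
    have hsub : cubes A1 ⊆ cubes A := image_subset_image (sub_subset_sub hA1 hA1)
    have hss : ((cubes A1 + cubes A1).card : ℝ) ≤ (cubes A + cubes A).card := by
      exact_mod_cast card_le_card (add_subset_add hsub hsub)
    have hnm : (A.card : ℝ) ≤ 4 * A1.card := by rw [hc1]; exact_mod_cast hn4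
    calc (A.card : ℝ) ^ 8 ≤ (4 * A1.card) ^ 8 := by gcongr
      _ = 4 ^ 8 * (A1.card : ℝ) ^ 8 := by rw [mul_pow]
      _ ≤ 4 ^ 8 * (((4 * 3 ^ 8) ^ 13 * 10368 ^ 5) * ((cubes A1 + cubes A1).card : ℝ) ^ 7) := by
        gcongr
      _ ≤ 4 ^ 8 * (((4 * 3 ^ 8) ^ 13 * 10368 ^ 5) * ((cubes A + cubes A).card : ℝ) ^ 7) := by
        gcongr
      _ = _ := (mul_assoc _ _ _).symm

end Final
end CubeExp

theorem stmt_0 :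
    ∃ c : ℝ, 0 < c ∧ ∀ (p : ℕ), p.Prime → 2 < p → ∀ A : Finset (ZMod p),
      (A.card : ℝ) ≤ (p : ℝ) ^ ((7 : ℝ) / 12) →
      c * (A.card : ℝ) ^ ((8 : ℝ) / 7) ≤
        ((((A ×ˢ A) ×ˢ (A ×ˢ A)).image
          (fun q => (q.1.1 - q.1.2) ^ 3 + (q.2.1 - q.2.2) ^ 3)).card : ℝ) := by
  obtain ⟨C, hC⟩ : ∃ C : ℝ, C = 4 ^ 8 * ((4 * 3 ^ 8) ^ 13 * 10368 ^ 5) := ⟨_, rfl⟩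
  have hC0 : 0 < C := by rw [hC]; positivity
  refine ⟨(C ^ ((1 : ℝ) / 7))⁻¹, by positivity, ?_⟩
  intro p hp _ A hA
  have : Fact p.Prime := ⟨hp⟩
  have hA12 : (A.card : ℝ) ^ 12 ≤ (p : ℝ) ^ 7 := by
    calc (A.card : ℝ) ^ 12 ≤ ((p : ℝ) ^ ((7 : ℝ) / 12)) ^ 12 := by gcongr
      _ = (p : ℝ) ^ 7 := by
        rw [← Real.rpow_natCast, ← Real.rpow_mul (Nat.cast_nonneg _)]
        norm_num
  have h := CubeExp.main_bound A hA12
  rw [← hC, ← CubeExp.image_eq] at h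
  have h1 := Real.rpow_le_rpow (by positivity) h (by norm_num : (0 : ℝ) ≤ 1 / 7)
  rw [Real.mul_rpow hC0.le (by positivity), ← Real.rpow_natCast, ← Real.rpow_natCast,
    ← Real.rpow_mul (by positivity), ← Real.rpow_mul (by positivity)] at h1
  norm_num at h1
  rw [inv_mul_le_iff₀ (by positivity)]
  norm_num
  exact h1
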